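/- arXiv:1307.6837 — 2 statements merged into one kernel-verified Lean document; each statement's English description precedes it below -/
import Mathlib

section
/- The boundary TSP approximates the TSP well on the unit cube: for d ≥ 2 there is a constant C(d) such that for every finite set F of n points in Ω = [0,1]^d, |T(F, Ω) − T_B(F, Ω)| ≤ C(d) n^{(d-2)/(d-1)}. -/
open MeasureTheory Filter

noncomputable section

/-- The unit hypercube `Ω = [0,1]^d` in `ℝ^d`. -/
def unitCube (d : ℕ) : Set (EuclideanSpace ℝ (Fin d)) :=
  {x | ∀ i, x i ∈ Set.Icc (0 : ℝ) 1}

/-- The subcube `ω_k` (for `k : Fin d → Fin m`) of the partition of `[0,1]^d` into `m^d`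
congruent subcubes of edge length `1/m` (half-open, except closed at the top face). -/
def cell {d : ℕ} (m : ℕ) (k : Fin d → Fin m) : Set (EuclideanSpace ℝ (Fin d)) :=
  {x | ∀ i, x i ∈ (if (k i : ℕ) + 1 = m
      then Set.Icc ((k i : ℝ) / m) (((k i : ℝ) + 1) / m)
      else Set.Ico ((k i : ℝ) / m) (((k i : ℝ) + 1) / m))}

/-- Length of the polygonal path visiting the points of the list `l` in order,
for the distance function `ρ`. -/
def pathLen {E : Type*} (ρ : E → E → ℝ) (l : List E) : ℝ :=
  (List.zipWith ρ l l.tail).sum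

/-- Length of the closed tour visiting the points of the list `l` in order and coming back
to the starting point, for the distance function `ρ`. -/
def tourLen {E : Type*} (ρ : E → E → ℝ) (l : List E) : ℝ :=
  pathLen ρ (l ++ l.take 1)

/-- `l` enumerates the points of the set `F` (each exactly once). -/
def Enumerates {E : Type*} (l : List E) (F : Set E) : Prop :=
  l.Nodup ∧ ∀ z, z ∈ l ↔ z ∈ F

/-- `T F`: the length of the shortest Hamiltonian path through the (finite) set `F`,
i.e. the minimum over orderings of `F` of the sum of consecutive Euclidean distances. -/
def T {E : Type*} [PseudoMetricSpace E] (F : Set E) : ℝ :=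
  sInf {L | ∃ l : List E, Enumerates l F ∧ pathLen dist l = L}

/-- The pseudometric obtained from the Euclidean metric by identifying all points of the
boundary `∂R` of `R`: `d(a,b) = min(dist a b, dist(a,∂R) + dist(b,∂R))`. -/
def bdist {E : Type*} [PseudoMetricSpace E] (R : Set E) (a b : E) : ℝ :=
  min (dist a b) (Metric.infDist a (frontier R) + Metric.infDist b (frontier R))

/-- `TB F R`: the boundary TSP, i.e. the length of the shortest Hamiltonian tour through
`F ∩ R` for the pseudometric obtained from the Euclidean one by identifying the points of
the boundary `∂R` (travel along the boundary is free). -/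
def TB {E : Type*} [PseudoMetricSpace E] (F R : Set E) : ℝ :=
  sInf {L | ∃ l : List E, Enumerates l (F ∩ R) ∧ tourLen (bdist R) l = L}

/-- Cumulative length of the polygonal path through `l` up to its `(j+1)`-st point. -/
def cumLen {E : Type*} [PseudoMetricSpace E] (l : List E) (j : ℕ) : ℝ :=
  pathLen dist (l.take (j + 1))

/-- `γ` is the constant-speed parameterization, on `[0,1]`, of the polygonal curve joining
the consecutive points of `l`: it traverses the segment from `l[j]` to `l[j+1]` affinely on
the time interval `[cumLen l j / pathLen l, cumLen l (j+1) / pathLen l]`. -/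
def IsConstSpeedParam {d : ℕ} (l : List (EuclideanSpace ℝ (Fin d)))
    (γ : ℝ → EuclideanSpace ℝ (Fin d)) : Prop :=
  ∀ j : ℕ, ∀ h : j + 1 < l.length, ∀ u : ℝ, u ∈ Set.Icc (0 : ℝ) 1 →
    γ (((1 - u) * cumLen l j + u * cumLen l (j + 1)) / pathLen dist l)
      = (1 - u) • l[j]'(Nat.lt_of_succ_lt h) + u • l[j + 1]'h

/-- `restLen l γ B`: the one-dimensional length of the portion lying in `B` of the polygonal
curve through `l` parameterized at constant speed by `γ` on `[0,1]`; equivalently,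
`pathLen l` times the time spent in `B`. -/
def restLen {d : ℕ} (l : List (EuclideanSpace ℝ (Fin d)))
    (γ : ℝ → EuclideanSpace ℝ (Fin d)) (B : Set (EuclideanSpace ℝ (Fin d))) : ℝ :=
  pathLen dist l * (volume (γ ⁻¹' B ∩ Set.Icc (0 : ℝ) 1)).toReal

/-- The first `N` sample points `X_N = {x_1, …, x_N}` of the sequence `x` at sample `ω`. -/
def sampleSet {α Ω₀ : Type*} (x : ℕ → Ω₀ → α) (N : ℕ) (ω : Ω₀) : Set α :=
  (fun i => x i ω) '' Set.Iio N


namespace BTSP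

set_option linter.unusedSectionVars false

inductive W {X : Type*} [PseudoMetricSpace X] : X → X → Set X → ℝ → Prop
  | nil (a : X) (S : Set X) (c : ℝ) (hS : S ⊆ {a}) (hc : 0 ≤ c) : W a a S c
  | cons (a b e : X) (S S' : Set X) (c c' : ℝ) (h : W b e S c) (hS : S' ⊆ insert a S)
      (hc : dist a b + c ≤ c') : W a e S' c'

section
variable {X : Type*} [PseudoMetricSpace X]

lemma W.mono {a b : X} {S S' : Set X} {c c' : ℝ} (h : W a b S c) (hS : S' ⊆ S) (hc : c ≤ c') :
    W a b S' c' := by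
  cases h with
  | nil _ _ _ h1 h2 => exact W.nil _ _ _ (hS.trans h1) (h2.trans hc)
  | cons _ b _ S0 _ c0 _ h h1 h2 => exact W.cons _ _ _ _ _ _ _ h (hS.trans h1) (h2.trans hc)

lemma W.nonneg {a b : X} {S : Set X} {c : ℝ} (h : W a b S c) : 0 ≤ c := by
  induction h with
  | nil _ _ _ h1 h2 => exact h2
  | cons a b e S S' c c' h hS hc ih => have := dist_nonneg (x := a) (y := b); linarith

lemma W.trans {a b e : X} {S S' : Set X} {c c' : ℝ} (h : W a b S c) (h' : W b e S' c')
    : W a e (S ∪ S') (c + c') := by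
  induction h with
  | nil a S c h1 h2 =>
    have hn := h'.nonneg
    refine W.cons a a e S' _ c' _ h' ?_ (by simp; linarith)
    intro x hx
    rcases hx with hx | hx
    · left; exact h1 hx
    · right; exact hx
  | cons a b e' S0 S1 c0 c1 h hS hc ih =>
    refine W.cons a b e _ _ _ _ (ih h') ?_ (by linarith : dist a b + (c0 + c') ≤ c1 + c')
    intro x hx
    rcases hx with hx | hx
    · rcases hS hx with h3 | h3
      · left; exact h3
      · right; left; exact h3
    · right; right; exact hx

lemma W.edge (a b : X) : W a b {a, b} (dist a b) :=
  W.cons a b b {b} _ 0 _ (W.nil b _ _ subset_rfl le_rfl) subset_rfl (by simp)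

lemma W.symm {a b : X} {S : Set X} {c : ℝ} (h : W a b S c) : W b a S c := by
  induction h with
  | nil a S c h1 h2 => exact W.nil a S c h1 h2
  | cons a b e S0 S1 c0 c1 h hS hc ih =>
    refine (ih.trans (W.edge b a)).mono ?_ (by rw [dist_comm]; linarith)
    intro x hx
    rcases hS hx with h3 | h3
    · right; right; exact h3
    · left; exact h3

lemma W.splice {a b x : X} {S S' : Set X} {c c' : ℝ} (h : W a b S c) (hx : x ∈ S)
    (h' : W x x S' c') : W a b (S ∪ S') (c + c') := by
  induction h with
  | nil a S c h1 h2 =>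
    obtain rfl : x = a := h1 hx
    exact (W.nil x S c h1 h2).trans h'
  | cons a b e S0 S1 c0 c1 h hS hc ih =>
    by_cases hxa : x = a
    · subst hxa
      refine (h'.trans (W.cons x b e S0 S1 c0 c1 h hS hc)).mono ?_ (by linarith)
      rw [Set.union_comm]
    · have h3 : x ∈ S0 := by
        rcases hS hx with h3 | h3
        · exact absurd h3 hxa
        · exact h3
      refine W.cons a b e _ _ _ _ (ih h3) ?_ (by linarith : dist a b + (c0 + c') ≤ c1 + c')
      intro y hy
      rcases hy with hy | hy
      · rcases hS hy with h4 | h4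
        · left; exact h4
        · right; left; exact h4
      · right; right; exact hy

lemma W.insert' {a b x y : X} {S : Set X} {c δ : ℝ} (h : W a b S c) (hx : x ∈ S)
    (hd : dist x y ≤ δ) : W a b (insert y S) (c + 2 * δ) := by
  refine (h.splice hx ((W.edge x y).trans (W.edge y x))).mono ?_ ?_
  · intro z hz
    rcases hz with hz | hz
    · right; left; right; exact hz
    · left; exact hz
  · rw [dist_comm y x]; linarith

lemma W.insert_list {a b : X} {S : Set X} {c δ : ℝ} (h : W a b S c) (E : List X)
    (hE : ∀ y ∈ E, ∃ x ∈ S, dist x y ≤ δ) :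
    W a b (S ∪ {y | y ∈ E}) (c + 2 * δ * E.length) := by
  induction E with
  | nil => simpa using h
  | cons y E ih =>
    obtain ⟨x, hx, hd⟩ := hE y (by simp)
    have := ih (fun z hz => hE z (by simp [hz]))
    refine (this.insert' (Or.inl hx) hd).mono ?_ ?_
    · intro z hz
      simp only [List.mem_cons, Set.mem_union, Set.mem_ofPred_eq, Set.mem_insert_iff] at hz ⊢
      tauto
    · push_cast [List.length_cons]; linarith

lemma pathLen_nil (ρ : X → X → ℝ) : pathLen ρ [] = 0 := by simp [pathLen]
lemma pathLen_one (ρ : X → X → ℝ) (a : X) : pathLen ρ [a] = 0 := by simp [pathLen]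
lemma pathLen_cons (ρ : X → X → ℝ) (a b : X) (l : List X) :
    pathLen ρ (a :: b :: l) = ρ a b + pathLen ρ (b :: l) := by simp [pathLen]

lemma pathLen_nonneg (ρ : X → X → ℝ) (hρ : ∀ a b, 0 ≤ ρ a b) (l : List X) : 0 ≤ pathLen ρ l := by
  induction l with
  | nil => simp [pathLen]
  | cons a l ih =>
    cases l with
    | nil => simp [pathLen]
    | cons b l => rw [pathLen_cons]; have := hρ a b; linarith

lemma pathLen_tail (ρ : X → X → ℝ) (hρ : ∀ a b, 0 ≤ ρ a b) (a : X) (l : List X) :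
    pathLen ρ l ≤ pathLen ρ (a :: l) := by
  cases l with
  | nil => simp [pathLen]
  | cons b l => rw [pathLen_cons]; have := hρ a b; linarith

lemma pathLen_replicate (a : X) (k : ℕ) (l : List X) :
    pathLen dist (a :: (List.replicate k a ++ l)) = pathLen dist (a :: l) := by
  induction k with
  | zero => simp
  | succ k ih => rw [List.replicate_succ, List.cons_append, pathLen_cons, ih]; simp

lemma pathLen_tri (a b : X) (l : List X) :
    pathLen dist (a :: l) ≤ dist a b + pathLen dist (b :: l) := by
  cases l with
  | nil => simp [pathLen]
  | cons x l => rw [pathLen_cons, pathLen_cons]; have := dist_triangle a b x; linarith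

lemma W.extract {a b : X} {S : Set X} {c : ℝ} (h : W a b S c) (E : Multiset X)
    (hE : ∀ x ∈ E, x ∈ S) : ∃ Y : List X, (Y : Multiset X) = E ∧ pathLen dist (a :: Y) ≤ c := by
  classical
  induction h generalizing E with
  | nil a S c h1 h2 =>
    refine ⟨List.replicate (Multiset.card E) a, ?_, ?_⟩
    · rw [Multiset.coe_replicate, eq_comm, Multiset.eq_replicate]
      exact ⟨rfl, fun x hx => h1 (hE x hx)⟩
    · have := pathLen_replicate a (Multiset.card E) []
      rw [List.append_nil] at this
      rw [this, pathLen_one]; exact h2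
  | cons a b e S0 S1 c0 c1 h hS hc ih =>
    obtain ⟨Y, hY, hl⟩ := ih (E.filter (fun x => ¬ x = a)) (by
      intro x hx
      rw [Multiset.mem_filter] at hx
      rcases hS (hE x hx.1) with h3 | h3
      · exact absurd h3 hx.2
      · exact h3)
    refine ⟨List.replicate (E.count a) a ++ Y, ?_, ?_⟩
    · rw [← Multiset.coe_add, hY, Multiset.coe_replicate, ← Multiset.filter_eq']
      exact Multiset.filter_add_not _ _
    · rw [pathLen_replicate]
      exact (pathLen_tri a b Y).trans (by linarith)

lemma W.T_le {a b : X} {S F : Set X} {c : ℝ} (h : W a b S c) (hF : F.Finite) (hS : F ⊆ S) :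
    T F ≤ c := by
  obtain ⟨Y, hY, hl⟩ := h.extract hF.toFinset.val (fun x hx => hS (by simpa using hx))
  have key : T F ≤ pathLen dist Y := by
    refine csInf_le ?_ ⟨Y, ⟨?_, ?_⟩, rfl⟩
    · refine ⟨0, ?_⟩
      rintro L ⟨l, _, rfl⟩
      exact pathLen_nonneg _ (fun _ _ => dist_nonneg) _
    · rw [← Multiset.coe_nodup, hY]; exact hF.toFinset.nodup
    · intro z
      rw [← Multiset.mem_coe, hY]; simp
  exact key.trans ((pathLen_tail dist (fun _ _ => dist_nonneg) a Y).trans hl)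

abbrev PT (X : Type*) := X × X × Set X × ℝ

def ends (P : Multiset (PT X)) : Multiset X := P.map (fun p => p.1) + P.map (fun p => p.2.1)
def cost (P : Multiset (PT X)) : ℝ := (P.map (fun p => p.2.2.2)).sum
def cov (P : Multiset (PT X)) : Set X := {x | ∃ p ∈ P, x ∈ p.2.2.1}
def Good (P : Multiset (PT X)) : Prop := ∀ p ∈ P, W p.1 p.2.1 p.2.2.1 p.2.2.2

lemma ends_cons (p : PT X) (P : Multiset (PT X)) :
    ends (p ::ₘ P) = p.1 ::ₘ p.2.1 ::ₘ ends P := by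
  simp [ends]
  exact Multiset.cons_swap _ _ _
lemma cost_cons (p : PT X) (P : Multiset (PT X)) :
    cost (p ::ₘ P) = p.2.2.2 + cost P := by
  simp [cost]
lemma cov_cons (p : PT X) (P : Multiset (PT X)) :
    cov (p ::ₘ P) = p.2.2.1 ∪ cov P := by
  ext x; simp [cov]
lemma good_cons {p : PT X} {P : Multiset (PT X)} :
    Good (p ::ₘ P) ↔ W p.1 p.2.1 p.2.2.1 p.2.2.2 ∧ Good P := by
  simp [Good]

lemma extractP {u : X} {P : Multiset (PT X)} (hP : Good P) (hu : u ∈ ends P) :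
    ∃ e S c P1, W u e S c ∧ Good P1 ∧ ends P = u ::ₘ e ::ₘ ends P1 ∧ cost P = c + cost P1 ∧
      cov P = S ∪ cov P1 := by
  have hu' : (∃ p ∈ P, p.1 = u) ∨ (∃ p ∈ P, p.2.1 = u) := by
    rw [ends, Multiset.mem_add, Multiset.mem_map, Multiset.mem_map] at hu; exact hu
  rcases hu' with ⟨p, hp, rfl⟩ | ⟨p, hp, rfl⟩
  · obtain ⟨P1, rfl⟩ := Multiset.exists_cons_of_mem hp
    rw [good_cons] at hP
    exact ⟨p.2.1, p.2.2.1, p.2.2.2, P1, hP.1, hP.2, ends_cons _ _, cost_cons _ _, cov_cons _ _⟩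
  · obtain ⟨P1, rfl⟩ := Multiset.exists_cons_of_mem hp
    rw [good_cons] at hP
    exact ⟨p.1, p.2.2.1, p.2.2.2, P1, hP.1.symm, hP.2, by rw [ends_cons, Multiset.cons_swap],
      cost_cons _ _, cov_cons _ _⟩

lemma merge (n : ℕ) : ∀ (Y : List X) (P : Multiset (PT X)) (a : X) (S0 : Set X) (c0 : ℝ),
    Y.length ≤ n → Good P → (Y : Multiset X) = ends P → (∀ y ∈ Y, y ∈ S0) → W a a S0 c0 →
    W a a (S0 ∪ cov P) (c0 + cost P + pathLen dist Y) := by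
  induction n with
  | zero =>
    intro Y P a S0 c0 hn hP hY hS hW
    obtain rfl : Y = [] := List.length_eq_zero_iff.mp (by omega)
    have : P = 0 := by
      have := congrArg Multiset.card hY
      simp [ends] at this
      exact Multiset.card_eq_zero.mp (by omega)
    subst this
    simpa [cov, cost, pathLen_nil] using hW
  | succ n ih =>
    intro Y P a S0 c0 hn hP hY hS hW
    match Y, hn, hY, hS with
    | [], _, hY, hS => exact ih [] P a S0 c0 (by simp) hP hY hS hW
    | [u], _, hY, hS =>
      have hu : u ∈ ends P := by rw [← hY]; simp
      obtain ⟨e, S, c, P1, h1, h2, h3, h4, h5⟩ := extractP hP hu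
      rw [h3] at hY
      have := congrArg Multiset.card hY
      simp at this
    | u :: v :: Y, hn, hY, hS =>
      have hlen : Y.length + 2 ≤ n + 1 := by simpa using hn
      have hu : u ∈ ends P := by rw [← hY]; simp
      obtain ⟨e, S, c, P1, h1, h2, h3, h4, h5⟩ := extractP hP hu
      have hpl : dist u v + pathLen dist Y ≤ pathLen dist (u :: v :: Y) := by
        rw [pathLen_cons]
        have := pathLen_tail dist (fun _ _ => dist_nonneg) v Y
        linarith
      rw [h3, ← Multiset.cons_coe, Multiset.cons_inj_right, ← Multiset.cons_coe] at hY
      by_cases hve : v = e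
      · subst hve
        rw [Multiset.cons_inj_right] at hY
        have hW' := hW.splice (hS u (by simp)) (h1.trans (W.edge v u))
        have := ih Y P1 a (S0 ∪ (S ∪ {v, u})) _ (by omega) h2 hY (fun y hy => Or.inl (hS y (by simp [hy]))) hW'
        refine this.mono ?_ ?_
        · rw [h5]
          intro x hx
          simp only [Set.mem_union] at hx ⊢
          tauto
        · rw [h4, dist_comm v u]; linarith
      · have hv : v ∈ ends P1 := by
          have : v ∈ e ::ₘ ends P1 := by rw [← hY]; simp
          rcases Multiset.mem_cons.mp this with h | h
          · exact absurd h hve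
          · exact h
        obtain ⟨e2, S2, c2, P2, k1, k2, k3, k4, k5⟩ := extractP h2 hv
        rw [k3, Multiset.cons_swap, Multiset.cons_inj_right] at hY
        have hW' : W e e2 (S ∪ S2) (c + dist u v + c2) := by
          refine ((h1.symm.trans (W.edge u v)).trans k1).mono ?_ le_rfl
          intro x hx
          simp only [Set.mem_union] at hx ⊢
          tauto
        have := ih Y ((e, e2, S ∪ S2, c + dist u v + c2) ::ₘ P2) a S0 c0 (by omega)
          (good_cons.mpr ⟨hW', k2⟩) (by rw [ends_cons]; exact hY)
          (fun y hy => hS y (by simp [hy])) hW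
        refine this.mono ?_ ?_
        · rw [h5, k5, cov_cons]
          intro x hx
          simp only [Set.mem_union] at hx ⊢
          tauto
        · rw [h4, k4, cost_cons]; simp only; linarith

lemma decomp (U : Set X) (proj : X → X) (hproj : ∀ x, proj x ∈ frontier U)
    (hd : ∀ x, dist x (proj x) = Metric.infDist x (frontier U)) (p0 : X) (hp0 : p0 ∈ frontier U)
    (D : ℝ) (l : List X) : ∀ x : X, (∀ y ∈ x :: l, dist y p0 ≤ D) →
    ∃ e S c P, W x e S c ∧ Good P ∧ e ∈ frontier U ∧ (∀ y ∈ ends P, y ∈ frontier U) ∧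
      (∀ y ∈ x :: l, y ∈ S ∪ cov P) ∧ c + cost P ≤ pathLen (bdist U) (x :: l) + D ∧
      Multiset.card P ≤ l.length := by
  induction l with
  | nil =>
    intro x hx
    refine ⟨p0, {x, p0}, dist x p0, 0, W.edge x p0, by simp [Good], hp0, by simp [ends], by simp,
      ?_, by simp⟩
    rw [pathLen_one]
    have := hx x (by simp)
    simpa [cost] using this
  | cons z l ih =>
    intro x hx
    obtain ⟨e, S, c, P, h1, h2, h3, h4, h5, h6, h7⟩ := ih z (fun y hy => hx y (by simp [hy]))
    rcases le_total (dist x z)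
      (Metric.infDist x (frontier U) + Metric.infDist z (frontier U)) with hle | hle
    · refine ⟨e, insert x S, dist x z + c, P, W.cons x z e S _ c _ h1 subset_rfl le_rfl, h2, h3, h4,
        ?_, ?_, by simp; omega⟩
      · intro y hy
        rcases List.mem_cons.mp hy with rfl | hy
        · left; left; rfl
        · rcases h5 y hy with h | h
          · left; right; exact h
          · right; exact h
      · rw [pathLen_cons, bdist, min_eq_left hle]; linarith
    · refine ⟨proj x, {x, proj x}, dist x (proj x),
        (proj z, e, {proj z, z} ∪ S, dist (proj z) z + c) ::ₘ P, W.edge _ _,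
        good_cons.mpr ⟨(W.edge _ _).trans h1, h2⟩, hproj x, ?_, ?_, ?_, by simp; omega⟩
      · intro y hy
        rw [ends_cons] at hy
        simp only [Multiset.mem_cons] at hy
        rcases hy with rfl | rfl | hy
        · exact hproj z
        · exact h3
        · exact h4 y hy
      · intro y hy
        rw [cov_cons]
        rcases List.mem_cons.mp hy with rfl | hy
        · left; left; rfl
        · rcases h5 y hy with h | h
          · right; left; right; exact h
          · right; right; exact h
      · rw [pathLen_cons, bdist, min_eq_right hle, cost_cons, dist_comm (proj z) z, hd, hd]
        simp only; linarith

lemma tree {ι : Type*} [DecidableEq ι] (g : ι → X) (w : ι → ℕ) (o : ι) (δ : ℝ) (hδ : 0 ≤ δ) (n : ℕ) :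
    ∀ A : Finset ι, A.card = n → o ∈ A →
    (∀ k ∈ A, k ≠ o → ∃ k' ∈ A, w k' < w k ∧ dist (g k') (g k) ≤ δ) →
    W (g o) (g o) (g '' A) (2 * δ * n) := by
  induction n with
  | zero => intro A hA ho; simp at hA; simp [hA] at ho
  | succ n ih =>
    intro A hA ho hpar
    by_cases hne : (A.erase o).Nonempty
    · obtain ⟨m, hm, hmax⟩ := Finset.exists_max_image _ w hne
      have hm' := Finset.mem_erase.mp hm
      have hpar' : ∀ k ∈ A, k ≠ o → ∃ k' ∈ A.erase m, w k' < w k ∧ dist (g k') (g k) ≤ δ := by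
        intro k hk hko
        obtain ⟨k', h1, h2, h3⟩ := hpar k hk hko
        refine ⟨k', Finset.mem_erase.mpr ⟨?_, h1⟩, h2, h3⟩
        rintro rfl
        exact absurd (hmax k (Finset.mem_erase.mpr ⟨hko, hk⟩)) (by omega)
      have := ih (A.erase m) (by rw [Finset.card_erase_of_mem hm'.2]; omega)
        (Finset.mem_erase.mpr ⟨hm'.1.symm, ho⟩)
        (fun k hk => hpar' k (Finset.mem_of_mem_erase hk))
      obtain ⟨k', h1, h2, h3⟩ := hpar' m hm'.2 hm'.1
      refine (this.insert' (Set.mem_image_of_mem g h1) h3).mono ?_ ?_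
      · rintro _ ⟨k, hk, rfl⟩
        by_cases hkm : k = m
        · left; rw [hkm]
        · right; exact ⟨k, by simpa [hkm] using hk, rfl⟩
      · push_cast; linarith
    · refine W.nil _ _ _ ?_ (by positivity)
      rintro _ ⟨k, hk, rfl⟩
      by_contra hko
      exact hne ⟨k, Finset.mem_erase.mpr ⟨fun h => hko (by rw [h]; rfl), hk⟩⟩

end

section cube
variable {d : ℕ}

lemma dist_le_of (x y : EuclideanSpace ℝ (Fin d)) (ε : ℝ) (hε : 0 ≤ ε)
    (h : ∀ i, |x i - y i| ≤ ε) : dist x y ≤ √d * ε := by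
  rw [EuclideanSpace.dist_eq]
  have h1 : ∑ i, dist (x i) (y i) ^ 2 ≤ d * ε ^ 2 := by
    calc ∑ i, dist (x i) (y i) ^ 2 ≤ ∑ _i : Fin d, ε ^ 2 := by
          apply Finset.sum_le_sum
          intro i _
          rw [Real.dist_eq]
          exact pow_le_pow_left₀ (abs_nonneg _) (h i) 2
      _ = d * ε ^ 2 := by simp
  calc √(∑ i, dist (x i) (y i) ^ 2) ≤ √(d * ε ^ 2) := Real.sqrt_le_sqrt h1
    _ = √d * ε := by rw [Real.sqrt_mul (by positivity), Real.sqrt_sq hε]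

lemma cube_dist {x y : EuclideanSpace ℝ (Fin d)} (hx : x ∈ unitCube d) (hy : y ∈ unitCube d) :
    dist x y ≤ √d := by
  have := dist_le_of x y 1 zero_le_one (fun i => by
    have h1 := hx i
    have h2 := hy i
    rw [Set.mem_Icc] at h1 h2
    rw [abs_le]; constructor <;> linarith)
  simpa using this

lemma cont_coord (i : Fin d) : Continuous (fun x : EuclideanSpace ℝ (Fin d) => x i) := by
  fun_prop

lemma cube_closed : IsClosed (unitCube d) := by
  have : unitCube d = ⋂ i, (fun x : EuclideanSpace ℝ (Fin d) => x i) ⁻¹' Set.Icc 0 1 := by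
    ext x; simp [unitCube]
  rw [this]
  exact isClosed_iInter fun i => isClosed_Icc.preimage (cont_coord i)

lemma frontier_sub {x : EuclideanSpace ℝ (Fin d)} (hx : x ∈ frontier (unitCube d)) :
    x ∈ unitCube d ∧ ∃ i, x i = 0 ∨ x i = 1 := by
  have h1 : x ∈ unitCube d := cube_closed.frontier_subset hx
  refine ⟨h1, ?_⟩
  by_contra hcon
  push Not at hcon
  apply hx.2
  rw [mem_interior]
  refine ⟨⋂ i, (fun x : EuclideanSpace ℝ (Fin d) => x i) ⁻¹' Set.Ioo 0 1, ?_, ?_, ?_⟩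
  · intro y hy i
    rw [Set.mem_iInter] at hy
    exact Set.Ioo_subset_Icc_self (hy i)
  · exact isOpen_iInter_of_finite fun i => isOpen_Ioo.preimage (cont_coord i)
  · rw [Set.mem_iInter]
    intro i
    exact ⟨lt_of_le_of_ne (h1 i).1 (hcon i).1.symm, lt_of_le_of_ne (h1 i).2 (hcon i).2⟩

lemma frontier_ne (hd : 2 ≤ d) : (frontier (unitCube d)).Nonempty := by
  rw [nonempty_frontier_iff]
  refine ⟨⟨0, fun i => by simp⟩, ?_⟩
  intro h
  have : (WithLp.toLp 2 (fun _ => (2 : ℝ)) : EuclideanSpace ℝ (Fin d)) ∈ unitCube d := by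
    rw [h]; trivial
  have := (this ⟨0, by omega⟩).2
  simp at this

def gp (s : ℕ) (k : Fin d → ℕ) : EuclideanSpace ℝ (Fin d) := WithLp.toLp 2 (fun i => (k i : ℝ) / s)

open Classical in
def grid (d s : ℕ) : Finset (Fin d → ℕ) :=
  (Fintype.piFinset fun _ => Finset.range (s + 1)).filter (fun k => ∃ i, k i = 0 ∨ k i = s)

lemma mem_grid {s : ℕ} {k : Fin d → ℕ} :
    k ∈ grid d s ↔ (∀ i, k i ≤ s) ∧ ∃ i, k i = 0 ∨ k i = s := by
  simp [grid, Nat.lt_succ_iff]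

lemma grid_slice (s v : ℕ) (i : Fin d) :
    (Fintype.piFinset (Function.update (fun _ : Fin d => Finset.range (s + 1)) i {v})).card
      = (s + 1) ^ (d - 1) := by
  rw [Fintype.card_piFinset]
  have : ∀ j, (Function.update (fun _ : Fin d => Finset.range (s + 1)) i {v} j).card
      = Function.update (fun _ : Fin d => s + 1) i 1 j := by
    intro j
    by_cases h : j = i
    · subst h; simp
    · simp [h]
  simp_rw [this]
  rw [Finset.prod_update_of_mem (Finset.mem_univ i)]
  simp [Finset.card_sdiff]

lemma grid_card (s : ℕ) : (grid d s).card ≤ 2 * d * (s + 1) ^ (d - 1) := by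
  classical
  have : grid d s ⊆ (Finset.univ : Finset (Fin d)).biUnion (fun i =>
      Fintype.piFinset (Function.update (fun _ : Fin d => Finset.range (s + 1)) i {0}) ∪
      Fintype.piFinset (Function.update (fun _ : Fin d => Finset.range (s + 1)) i {s})) := by
    intro k hk
    rw [mem_grid] at hk
    obtain ⟨h1, i, hi⟩ := hk
    rw [Finset.mem_biUnion]
    refine ⟨i, Finset.mem_univ _, ?_⟩
    rw [Finset.mem_union]
    have aux : ∀ v, k i = v → k ∈ Fintype.piFinset
        (Function.update (fun _ : Fin d => Finset.range (s + 1)) i {v}) := by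
      intro v hv
      rw [Fintype.mem_piFinset]
      intro j
      by_cases h : j = i
      · subst h; simp [hv]
      · have := h1 j
        simp [h]; omega
    exact hi.imp (aux 0) (aux s)
  refine (Finset.card_le_card this).trans (Finset.card_biUnion_le.trans ?_)
  calc _ ≤ ∑ _i : Fin d, ((s + 1) ^ (d - 1) + (s + 1) ^ (d - 1)) := by
        apply Finset.sum_le_sum
        intro i _
        refine (Finset.card_union_le _ _).trans ?_
        rw [grid_slice, grid_slice]
    _ = 2 * d * (s + 1) ^ (d - 1) := by simp; ring

lemma grid_dec {s : ℕ} (hs : 1 ≤ s) {k : Fin d → ℕ} (j : Fin d) (hj : k j ≠ 0) :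
    (∑ i, Function.update k j (k j - 1) i < ∑ i, k i) ∧
    dist (gp s (Function.update k j (k j - 1))) (gp s k) ≤ √d * (1 / s) := by
  constructor
  · apply Finset.sum_lt_sum
    · intro i _
      by_cases h : i = j
      · subst h; simp
      · simp [h]
    · exact ⟨j, Finset.mem_univ _, by simp; omega⟩
  · apply dist_le_of _ _ _ (by positivity)
    intro i
    have hs' : (0 : ℝ) < s := by exact_mod_cast hs
    by_cases h : i = j
    · subst h
      have h1 : 1 ≤ k i := by omega
      simp only [gp, Function.update_self]
      rw [← sub_div, Nat.cast_sub h1, abs_div, abs_of_pos hs']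
      simp
    · simp [gp, h]

lemma grid_parent (hd : 2 ≤ d) {s : ℕ} (hs : 1 ≤ s) (k : Fin d → ℕ) (hk : k ∈ grid d s)
    (h0 : k ≠ 0) : ∃ k' ∈ grid d s, (∑ i, k' i < ∑ i, k i) ∧
      dist (gp s k') (gp s k) ≤ √d * (1 / s) := by
  rw [mem_grid] at hk
  obtain ⟨h1, i, hi⟩ := hk
  have hle : ∀ j l, Function.update k j (k j - 1) l ≤ s := by
    intro j l
    have := h1 l
    by_cases h : l = j
    · subst h; simp; omega
    · simp [h]; omega
  by_cases hex : ∃ j, j ≠ i ∧ k j ≠ 0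
  · obtain ⟨j, hji, hj⟩ := hex
    refine ⟨_, mem_grid.mpr ⟨hle j, i, ?_⟩, grid_dec hs j hj⟩
    rw [Function.update_of_ne hji.symm]; exact hi
  · push Not at hex
    have hi0 : k i ≠ 0 := by
      intro h
      apply h0
      ext j
      by_cases hj : j = i
      · rw [hj, h]; rfl
      · exact hex j hj
    haveI : Nontrivial (Fin d) := Fin.nontrivial_iff_two_le.mpr hd
    obtain ⟨j, hj⟩ := exists_ne i
    refine ⟨_, mem_grid.mpr ⟨hle i, j, ?_⟩, grid_dec hs i hi0⟩
    rw [Function.update_of_ne hj]; left; exact hex j hj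

lemma grid_approx {s : ℕ} (hs : 1 ≤ s) (x : EuclideanSpace ℝ (Fin d))
    (hx : x ∈ frontier (unitCube d)) : ∃ k ∈ grid d s, dist (gp s k) x ≤ √d * (1 / s) := by
  obtain ⟨h1, i, hi⟩ := frontier_sub hx
  have hs' : (0 : ℝ) < s := by exact_mod_cast hs
  refine ⟨fun i => ⌊s * x i⌋₊, mem_grid.mpr ⟨?_, i, ?_⟩, ?_⟩
  · intro j
    apply Nat.floor_le_of_le
    have := (h1 j).2
    nlinarith
  · rcases hi with hi | hi
    · left; simp [hi]
    · right; simp [hi]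
  · apply dist_le_of _ _ _ (by positivity)
    intro j
    have h0 : 0 ≤ s * x j := mul_nonneg hs'.le (h1 j).1
    have ha := Nat.floor_le h0
    have hb := Nat.lt_floor_add_one (s * x j)
    simp only [gp]
    have : (⌊s * x j⌋₊ : ℝ) / s - x j = (⌊s * x j⌋₊ - s * x j) / s := by field_simp
    rw [this, abs_div, abs_of_pos hs']
    gcongr
    rw [abs_le]; constructor <;> linarith

lemma bw0 (hd : 2 ≤ d) {s : ℕ} (hs : 1 ≤ s) (E : List (EuclideanSpace ℝ (Fin d)))
    (hE : ∀ x ∈ E, x ∈ frontier (unitCube d)) :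
    ∃ a S, W a a S (2 * (√d * (1 / s)) * (2 * d * (s + 1) ^ (d - 1) : ℕ)
      + 2 * (√d * (1 / s)) * E.length) ∧ ∀ x ∈ E, x ∈ S := by
  classical
  have h := tree (gp (d := d) s) (fun k => ∑ i, k i) 0 (√d * (1 / s)) (by positivity) _
    (grid d s) rfl (mem_grid.mpr ⟨fun i => by simp, ⟨0, by omega⟩, by simp⟩)
    (fun k hk h0 => grid_parent hd hs k hk h0)
  have h2 := h.insert_list (δ := √d * (1 / s)) E (fun y hy => by
    obtain ⟨k, hk, hkd⟩ := grid_approx hs y (hE y hy)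
    exact ⟨_, ⟨k, hk, rfl⟩, hkd⟩)
  refine ⟨_, _, h2.mono subset_rfl ?_, fun x hx => Or.inr hx⟩
  have := grid_card (d := d) s
  gcongr

lemma choose_s (hd : 2 ≤ d) (n : ℕ) (hn : 1 ≤ n) : ∃ s : ℕ, 1 ≤ s ∧
    ((s : ℝ) + 1) ^ (d - 1) / s ≤ 4 ^ (d - 1) * (n : ℝ) ^ (((d:ℝ) - 2) / ((d:ℝ) - 1)) ∧
    (n : ℝ) / s ≤ (n : ℝ) ^ (((d:ℝ) - 2) / ((d:ℝ) - 1)) := by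
  obtain ⟨q, rfl⟩ : ∃ q, d = q + 2 := ⟨d - 2, by omega⟩
  have hn' : (1 : ℝ) ≤ n := by exact_mod_cast hn
  have hn0 : (0 : ℝ) < n := by linarith
  set r : ℝ := (n : ℝ) ^ (1 / ((q : ℝ) + 1)) with hr
  have hr1 : 1 ≤ r := Real.one_le_rpow hn' (by positivity)
  have hq : (n : ℝ) ^ ((((q + 2 : ℕ):ℝ) - 2) / (((q + 2 : ℕ):ℝ) - 1)) = r ^ q := by
    rw [hr, ← Real.rpow_natCast, ← Real.rpow_mul hn0.le]
    congr 1
    push_cast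
    have : (q : ℝ) + 2 - 1 = q + 1 := by ring
    rw [this]; ring
  have hq1 : (n : ℝ) = r ^ q * r := by
    rw [← pow_succ, hr, ← Real.rpow_natCast, ← Real.rpow_mul hn0.le]
    push_cast
    rw [one_div_mul_cancel (by positivity), Real.rpow_one]
  rw [hq]
  have hs1 := Nat.le_ceil r
  have hs2 := Nat.ceil_lt_add_one (by linarith : 0 ≤ r)
  refine ⟨⌈r⌉₊, Nat.one_le_ceil_iff.mpr (by linarith), ?_, ?_⟩
  · have hpos : (0 : ℝ) < ⌈r⌉₊ := by linarith
    rw [div_le_iff₀ hpos]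
    have e : q + 2 - 1 = q + 1 := by omega
    rw [e]
    calc ((⌈r⌉₊ : ℝ) + 1) ^ (q + 1) ≤ (4 * r) ^ (q + 1) := by
          gcongr; linarith
      _ = 4 ^ (q + 1) * r ^ q * r := by rw [mul_pow, pow_succ r]; ring
      _ ≤ _ := by gcongr
  · have hpos : (0 : ℝ) < ⌈r⌉₊ := by linarith
    rw [div_le_iff₀ hpos, hq1]
    gcongr

lemma bw (hd : 2 ≤ d) : ∃ C : ℝ, 0 ≤ C ∧ ∀ n : ℕ, 1 ≤ n →
    ∀ E : List (EuclideanSpace ℝ (Fin d)), E.length ≤ 2 * n →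
    (∀ x ∈ E, x ∈ frontier (unitCube d)) →
    ∃ a S, W a a S (C * (n : ℝ) ^ (((d:ℝ) - 2) / ((d:ℝ) - 1))) ∧ ∀ x ∈ E, x ∈ S := by
  refine ⟨2 * √d * (2 * d * 4 ^ (d - 1)) + 4 * √d, by positivity, ?_⟩
  intro n hn E hlen hE
  obtain ⟨s, hs, h1, h2⟩ := choose_s hd n hn
  obtain ⟨a, S, hW, hS⟩ := bw0 hd hs E hE
  refine ⟨a, S, hW.mono subset_rfl ?_, hS⟩
  have hlen' : (E.length : ℝ) ≤ 2 * n := by exact_mod_cast hlen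
  push_cast
  calc _ ≤ 2 * (√d * (1 / s)) * (2 * d * ((s : ℝ) + 1) ^ (d - 1)) +
        2 * (√d * (1 / s)) * (2 * n) := by gcongr
    _ = 2 * √d * (2 * d * (((s : ℝ) + 1) ^ (d - 1) / s)) + 4 * √d * (n / s) := by ring
    _ ≤ 2 * √d * (2 * d * (4 ^ (d - 1) * (n : ℝ) ^ (((d:ℝ) - 2) / ((d:ℝ) - 1))))
        + 4 * √d * (n : ℝ) ^ (((d:ℝ) - 2) / ((d:ℝ) - 1)) := by gcongr
    _ = _ := by ring

end cube

lemma bdist_nonneg {X : Type*} [PseudoMetricSpace X] (U : Set X) (a b : X) : 0 ≤ bdist U a b :=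
  le_min dist_nonneg (add_nonneg Metric.infDist_nonneg Metric.infDist_nonneg)

lemma pathLen_mono {X : Type*} [PseudoMetricSpace X] (ρ ρ' : X → X → ℝ) (h : ∀ a b, ρ a b ≤ ρ' a b)
    (l : List X) : pathLen ρ l ≤ pathLen ρ' l := by
  induction l with
  | nil => simp [pathLen]
  | cons a l ih =>
    cases l with
    | nil => simp [pathLen]
    | cons b l => rw [pathLen_cons, pathLen_cons]; exact add_le_add (h a b) ih

lemma pathLen_snoc {X : Type*} [PseudoMetricSpace X] (ρ : X → X → ℝ) (z : X) (l : List X) :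
    ∀ a, ∃ y ∈ a :: l, pathLen ρ (a :: l ++ [z]) = pathLen ρ (a :: l) + ρ y z := by
  induction l with
  | nil => intro a; exact ⟨a, by simp, by simp [pathLen]⟩
  | cons b l ih =>
    intro a
    obtain ⟨y, hy, h⟩ := ih b
    refine ⟨y, by simp [hy], ?_⟩
    rw [List.cons_append, List.cons_append, pathLen_cons, ← List.cons_append, h, pathLen_cons]
    ring

lemma tour_cons {X : Type*} [PseudoMetricSpace X] (ρ : X → X → ℝ) (a : X) (l : List X) :
    ∃ y ∈ a :: l, tourLen ρ (a :: l) = pathLen ρ (a :: l) + ρ y a := by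
  simpa [tourLen] using pathLen_snoc ρ a l a

lemma enum_exists {X : Type*} (F : Set X) (hF : F.Finite) : ∃ l, Enumerates l F :=
  ⟨hF.toFinset.toList, hF.toFinset.nodup_toList, by simp⟩

lemma main_upper {d : ℕ} (hd : 2 ≤ d) : ∃ C : ℝ, 0 ≤ C ∧
    ∀ F : Set (EuclideanSpace ℝ (Fin d)), F.Finite → F.Nonempty → F ⊆ unitCube d →
    ∀ l, Enumerates l F →
    T F ≤ tourLen (bdist (unitCube d)) l
      + C * (F.ncard : ℝ) ^ (((d:ℝ) - 2) / ((d:ℝ) - 1)) := by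
  obtain ⟨C, hC, hbw⟩ := bw hd
  refine ⟨2 * C + 2 * √d, by positivity, ?_⟩
  intro F hF hne hFU l hl
  obtain ⟨p0, hp0⟩ := frontier_ne hd
  have hproj : ∀ x : EuclideanSpace ℝ (Fin d), ∃ y ∈ frontier (unitCube d),
      dist x y = Metric.infDist x (frontier (unitCube d)) := by
    intro x
    obtain ⟨y, hy, h⟩ := isClosed_frontier.exists_infDist_eq_dist ⟨p0, hp0⟩ x
    exact ⟨y, hy, h.symm⟩
  choose proj hpr hpd using hproj
  obtain ⟨x, l, rfl⟩ : ∃ x l', l = x :: l' := by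
    cases l with
    | nil =>
      obtain ⟨z, hz⟩ := hne
      have := (hl.2 z).mpr hz
      simp at this
    | cons x l => exact ⟨x, l, rfl⟩
  have hcard : F.ncard = l.length + 1 := by
    classical
    have : F = ((x :: l).toFinset : Set _) := by
      ext z; simpa using (hl.2 z).symm
    rw [this, Set.ncard_coe_finset, List.toFinset_card_of_nodup hl.1]; simp
  have hmemU : ∀ y ∈ x :: l, y ∈ unitCube d := fun y hy => hFU ((hl.2 y).mp hy)
  have hp0U := (frontier_sub hp0).1
  obtain ⟨e, S, c, P, h1, h2, h3, h4, h5, h6, h7⟩ := decomp (unitCube d) proj hpr hpd p0 hp0 (√d) l x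
    (fun y hy => cube_dist (hmemU y hy) hp0U)
  set P' : Multiset (PT (EuclideanSpace ℝ (Fin d))) := (p0, e, {p0, x} ∪ S, dist p0 x + c) ::ₘ P with hP'
  have g1 : Good P' := good_cons.mpr ⟨(W.edge p0 x).trans h1, h2⟩
  have g2 : ∀ y ∈ ends P', y ∈ frontier (unitCube d) := by
    intro y hy
    rw [hP', ends_cons] at hy
    simp only [Multiset.mem_cons] at hy
    rcases hy with rfl | rfl | hy
    · exact hp0
    · exact h3
    · exact h4 y hy
  have g3 : Multiset.card (ends P') ≤ 2 * F.ncard := by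
    rw [hcard]
    simp [ends, hP']
    omega
  obtain ⟨a, S0, hW, hS0⟩ := hbw F.ncard (by omega) (ends P').toList (by simpa using g3)
    (fun y hy => g2 y (by simpa using hy))
  obtain ⟨Y, hY, hYl⟩ := hW.extract (ends P') (fun y hy => hS0 y (by simpa using hy))
  have hfin := merge _ Y P' a S0 _ le_rfl g1 hY (fun y hy => hS0 y (by
    rw [Multiset.mem_toList, ← hY]; exact hy)) hW
  have hT := hfin.T_le hF (by
    intro z hz
    right
    rw [hP', cov_cons]
    rcases h5 z ((hl.2 z).mpr hz) with h | h
    · left; right; exact h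
    · right; exact h)
  refine hT.trans ?_
  have hYl' := (pathLen_tail dist (fun _ _ => dist_nonneg) a Y).trans hYl
  obtain ⟨y, -, htour⟩ := tour_cons (bdist (unitCube d)) x l
  have hb := bdist_nonneg (unitCube d) y x
  have hpx := cube_dist hp0U (hmemU x (by simp))
  have hone : 1 ≤ (F.ncard : ℝ) ^ (((d:ℝ) - 2) / ((d:ℝ) - 1)) := by
    have hd' : (2 : ℝ) ≤ d := by exact_mod_cast hd
    apply Real.one_le_rpow
    · rw [hcard]; push_cast; linarith [Nat.cast_nonneg (α := ℝ) l.length]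
    · exact div_nonneg (by linarith) (by linarith)
  have hsq : √d ≤ √d * (F.ncard : ℝ) ^ (((d:ℝ) - 2) / ((d:ℝ) - 1)) :=
    le_mul_of_one_le_right (Real.sqrt_nonneg _) hone
  rw [htour, hP', cost_cons]
  simp only
  linarith

end BTSP

open BTSP

/-- The boundary TSP approximates the TSP well on the unit cube: for `d ≥ 2` there is a
constant `C(d)` such that for every finite set `F` of `n` points in `Ω = [0,1]^d`,
`|T(F, Ω) − T_B(F, Ω)| ≤ C(d) · n^((d-2)/(d-1))`. -/
theorem abs_TSP_sub_boundaryTSP_le (d : ℕ) (hd : 2 ≤ d) :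
    ∃ C : ℝ, ∀ F : Set (EuclideanSpace ℝ (Fin d)), F.Finite → F ⊆ unitCube d →
      |T (F ∩ unitCube d) - TB F (unitCube d)|
        ≤ C * (F.ncard : ℝ) ^ (((d:ℝ) - 2) / ((d:ℝ) - 1)) := by
  obtain ⟨C, hC, hup⟩ := main_upper hd
  refine ⟨C + √d, ?_⟩
  intro F hF hFU
  have hFe : F ∩ unitCube d = F := Set.inter_eq_left.mpr hFU
  rw [TB, hFe]
  rcases F.eq_empty_or_nonempty with rfl | hne
  · have hnil : ∀ l : List (EuclideanSpace ℝ (Fin d)), Enumerates l ∅ ↔ l = [] := by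
      intro l
      constructor
      · intro h
        exact List.eq_nil_iff_forall_not_mem.mpr fun z hz => (h.2 z).mp hz
      · rintro rfl
        exact ⟨by simp, by simp⟩
    have e1 : T (∅ : Set (EuclideanSpace ℝ (Fin d))) = 0 := by
      simp [T, hnil, pathLen]
    simp only [e1, hnil]
    simp [tourLen, pathLen]
    positivity
  have hone : 1 ≤ (F.ncard : ℝ) ^ (((d:ℝ) - 2) / ((d:ℝ) - 1)) := by
    have hd' : (2 : ℝ) ≤ d := by exact_mod_cast hd
    apply Real.one_le_rpow
    · have := (Set.ncard_pos hF).mpr hne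
      exact_mod_cast this
    · exact div_nonneg (by linarith) (by linarith)
  have hsq : √d ≤ √d * (F.ncard : ℝ) ^ (((d:ℝ) - 2) / ((d:ℝ) - 1)) :=
    le_mul_of_one_le_right (Real.sqrt_nonneg _) hone
  obtain ⟨l0, hl0⟩ := enum_exists F hF
  have hA : T F - C * (F.ncard : ℝ) ^ (((d:ℝ) - 2) / ((d:ℝ) - 1)) ≤
      sInf {L | ∃ l, Enumerates l F ∧ tourLen (bdist (unitCube d)) l = L} := by
    refine le_csInf ⟨_, l0, hl0, rfl⟩ ?_
    rintro L ⟨l, hl, rfl⟩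
    have := hup F hF hne hFU l hl
    linarith
  have hB : sInf {L | ∃ l, Enumerates l F ∧ tourLen (bdist (unitCube d)) l = L} - √d ≤ T F := by
    refine le_csInf ⟨_, l0, hl0, rfl⟩ ?_
    rintro L ⟨l, hl, rfl⟩
    have h1 : sInf {L | ∃ l, Enumerates l F ∧ tourLen (bdist (unitCube d)) l = L} ≤
        tourLen (bdist (unitCube d)) l := by
      refine csInf_le ⟨0, ?_⟩ ⟨l, hl, rfl⟩
      rintro L ⟨l', _, rfl⟩
      exact pathLen_nonneg _ (bdist_nonneg _) _
    cases l with
    | nil =>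
      obtain ⟨z, hz⟩ := hne
      have := (hl.2 z).mpr hz
      simp at this
    | cons x l =>
      obtain ⟨y, hy, h2⟩ := tour_cons (bdist (unitCube d)) x l
      have h3 := pathLen_mono (bdist (unitCube d)) dist (fun a b => min_le_left _ _) (x :: l)
      have h4 : bdist (unitCube d) y x ≤ dist y x := min_le_left _ _
      have h5 := cube_dist (hFU ((hl.2 y).mp hy)) (hFU ((hl.2 x).mp (by simp)))
      linarith
  have hCn : 0 ≤ C * (F.ncard : ℝ) ^ (((d:ℝ) - 2) / ((d:ℝ) - 1)) := by positivity
  have hsn := Real.sqrt_nonneg (d : ℝ)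
  rw [abs_le, add_mul]
  constructor <;> linarith

end
end

section
/- The TSP in the unit cube is well approximated by the sum of the TSPs over a grid of congruent subcubes: for d ≥ 2 and an integer m ≥ 1, there is a constant C(d,m) such that for every finite set F of n points in Ω = [0,1]^d, |T(F, Ω) − Σ_{i=1}^{m^d} T(F, ω_i)| ≤ C(d,m) n^{(d-2)/(d-1)}, where (ω_i) are the m^d congruent subcubes of edge length 1/m partitioning Ω. -/
open MeasureTheory Filter

noncomputable section

section Helpers

theorem pathLen_nil' {E : Type*} (ρ : E → E → ℝ) : pathLen ρ [] = 0 := by simp [pathLen]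
theorem pathLen_single {E : Type*} (ρ : E → E → ℝ) (a : E) : pathLen ρ [a] = 0 := by
  simp [pathLen]
theorem pathLen_cons2 {E : Type*} (ρ : E → E → ℝ) (a b : E) (l : List E) :
    pathLen ρ (a :: b :: l) = ρ a b + pathLen ρ (b :: l) := by simp [pathLen]

theorem pathLen_nonneg' {E : Type*} (ρ : E → E → ℝ) (h : ∀ x y, 0 ≤ ρ x y) (l : List E) :
    0 ≤ pathLen ρ l := by
  induction l with
  | nil => simp [pathLen]
  | cons a l ih =>
    cases l with
    | nil => simp [pathLen]
    | cons b l => rw [pathLen_cons2]; linarith [h a b]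

theorem pathLen_le_cons {E : Type*} (ρ : E → E → ℝ) (h : ∀ x y, 0 ≤ ρ x y) (a : E) (l : List E) :
    pathLen ρ l ≤ pathLen ρ (a :: l) := by
  cases l with
  | nil => simp [pathLen]
  | cons b l => rw [pathLen_cons2]; linarith [h a b]

theorem pathLen_append_le {E : Type*} (ρ : E → E → ℝ) (M : ℝ) (hM : 0 ≤ M) (l₁ l₂ : List E)
    (h : ∀ x ∈ l₁, ∀ y ∈ l₂, ρ x y ≤ M) :
    pathLen ρ (l₁ ++ l₂) ≤ pathLen ρ l₁ + pathLen ρ l₂ + M := by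
  induction l₁ with
  | nil => simp [pathLen_nil', hM]
  | cons a l ih =>
    cases l with
    | nil =>
      cases l₂ with
      | nil => simp [pathLen_nil', pathLen_single, hM]
      | cons b l₂ =>
        simp only [List.cons_append, List.nil_append, pathLen_cons2, pathLen_single]
        have := h a (by simp) b (by simp)
        linarith
    | cons b l =>
      have := ih (fun x hx y hy => h x (List.mem_cons_of_mem _ hx) y hy)
      simp only [List.cons_append, pathLen_cons2] at this ⊢
      linarith

theorem pathLen_le_add {E : Type*} (ρ ρ' : E → E → ℝ) (w : ℝ) (hw : 0 ≤ w) (l : List E)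
    (h : ∀ x ∈ l, ∀ y ∈ l, ρ' x y ≤ ρ x y + w) :
    pathLen ρ' l ≤ pathLen ρ l + l.length * w := by
  induction l with
  | nil => simp [pathLen_nil']
  | cons a l ih =>
    have ih' := ih (fun x hx y hy => h x (List.mem_cons_of_mem _ hx) y (List.mem_cons_of_mem _ hy))
    cases l with
    | nil => simp [pathLen_single, hw]
    | cons b l =>
      have := h a (by simp) b (by simp)
      rw [pathLen_cons2, pathLen_cons2]
      rw [List.length_cons]
      push_cast
      linarith

theorem pathLen_sublist_aux {E : Type*} [PseudoMetricSpace E] {l₁ l₂ : List E}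
    (h : l₁.Sublist l₂) : ∀ a, pathLen dist (a :: l₁) ≤ pathLen dist (a :: l₂) := by
  induction h with
  | slnil => intro a; exact le_rfl
  | @cons l₁ l₂ b _ ih =>
    intro a
    refine (ih a).trans ?_
    cases l₂ with
    | nil => rw [pathLen_single, pathLen_cons2, pathLen_single]; linarith [dist_nonneg (x := a) (y := b)]
    | cons c l =>
      rw [pathLen_cons2, pathLen_cons2, pathLen_cons2]
      linarith [dist_triangle a b c]
  | @cons_cons l₁ l₂ b _ ih =>
    intro a
    rw [pathLen_cons2, pathLen_cons2]
    linarith [ih b]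

theorem pathLen_sublist {E : Type*} [PseudoMetricSpace E] {l₁ l₂ : List E}
    (h : l₁.Sublist l₂) : pathLen dist l₁ ≤ pathLen dist l₂ := by
  induction h with
  | slnil => exact le_rfl
  | @cons l₁ l₂ b _ ih => exact ih.trans (pathLen_le_cons _ (fun _ _ => dist_nonneg) _ _)
  | @cons_cons l₁ l₂ b h _ => exact pathLen_sublist_aux h b

theorem T_le {E : Type*} [PseudoMetricSpace E] (A : Set E) (w : List E) (h : ∀ x ∈ A, x ∈ w) :
    T A ≤ pathLen dist w := by
  classical
  have hs : ((w.filter (fun x => decide (x ∈ A))).dedup).Sublist w :=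
    (List.dedup_sublist _).trans List.filter_sublist
  refine le_trans ?_ (pathLen_sublist hs)
  refine csInf_le ⟨0, ?_⟩ ⟨_, ⟨List.nodup_dedup _, ?_⟩, rfl⟩
  · rintro _ ⟨l, -, rfl⟩
    exact pathLen_nonneg' _ (fun _ _ => dist_nonneg) l
  · intro z
    simp only [List.mem_dedup, List.mem_filter, decide_eq_true_eq]
    exact ⟨fun h => h.2, fun hz => ⟨h z hz, hz⟩⟩

theorem le_T {E : Type*} [PseudoMetricSpace E] (A : Set E) (hA : A.Finite) (c : ℝ)
    (h : ∀ l, Enumerates l A → c ≤ pathLen dist l) : c ≤ T A := by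
  refine le_csInf ?_ ?_
  · refine ⟨_, hA.toFinset.toList, ⟨Finset.nodup_toList _, ?_⟩, rfl⟩
    intro z; simp
  · rintro _ ⟨l, hl, rfl⟩
    exact h l hl

theorem T_empty {E : Type*} [PseudoMetricSpace E] : T (∅ : Set E) = 0 := by
  refine le_antisymm ?_ ?_
  · simpa [pathLen_nil'] using T_le (∅ : Set E) [] (by simp)
  · exact le_T _ Set.finite_empty _ fun l _ => pathLen_nonneg' _ (fun _ _ => dist_nonneg) l

/-- there is a path from `a` to `b` covering `A` of length at most `c` -/
def HW {E : Type*} [PseudoMetricSpace E] (a b : E) (A : Set E) (c : ℝ) : Prop :=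
  ∃ l : List E, (∀ x ∈ A, x ∈ a :: (l ++ [b])) ∧ pathLen dist (a :: (l ++ [b])) ≤ c

theorem pathLen_snoc {E : Type*} (ρ : E → E → ℝ) (a b c : E) (l : List E) :
    pathLen ρ (a :: (l ++ [b] ++ [c])) = pathLen ρ (a :: (l ++ [b])) + ρ b c := by
  induction l generalizing a with
  | nil => simp [pathLen]
  | cons d l ih =>
    have := ih d
    simp only [List.cons_append, pathLen_cons2] at this ⊢
    linarith

theorem pathLen_join {E : Type*} (ρ : E → E → ℝ) (a b : E) (l l' : List E) :
    pathLen ρ (a :: (l ++ b :: l')) = pathLen ρ (a :: (l ++ [b])) + pathLen ρ (b :: l') := by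
  induction l generalizing a with
  | nil => simp [pathLen]
  | cons d l ih =>
    have := ih d
    simp only [List.cons_append, pathLen_cons2] at this ⊢
    linarith

theorem pathLen_reverse {E : Type*} [PseudoMetricSpace E] (l : List E) :
    pathLen dist l.reverse = pathLen dist l := by
  induction l with
  | nil => rfl
  | cons a l ih =>
    cases l with
    | nil => simp
    | cons b l =>
      rw [pathLen_cons2, ← ih]
      simp only [List.reverse_cons, List.append_assoc]
      cases hr : l.reverse with
      | nil => simp [pathLen, dist_comm]
      | cons c r =>
        have := pathLen_snoc (dist : E → E → ℝ) c b a r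
        simp only [List.cons_append, List.append_assoc] at this ⊢
        rw [this, dist_comm b a]; ring

theorem HW.symm {E : Type*} [PseudoMetricSpace E] {a b : E} {A : Set E} {c : ℝ}
    (h : HW a b A c) : HW b a A c := by
  obtain ⟨l, h1, h2⟩ := h
  have e : b :: (l.reverse ++ [a]) = (a :: (l ++ [b])).reverse := by simp
  refine ⟨l.reverse, ?_, ?_⟩
  · intro x hx
    rw [e, List.mem_reverse]; exact h1 x hx
  · rw [e, pathLen_reverse]; exact h2

theorem HW.trans {E : Type*} [PseudoMetricSpace E] {a b a' b' : E} {A A' : Set E} {c c' : ℝ}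
    (h : HW a b A c) (h' : HW a' b' A' c') : HW a b' (A ∪ A') (c + dist b a' + c') := by
  obtain ⟨l, h1, h2⟩ := h
  obtain ⟨l', h1', h2'⟩ := h'
  refine ⟨l ++ b :: a' :: l', ?_, ?_⟩
  · rintro x (hx | hx)
    · have := h1 x hx
      simp at this ⊢; tauto
    · have := h1' x hx
      simp at this ⊢; tauto
  · have := pathLen_join (dist : E → E → ℝ) a b l (a' :: (l' ++ [b']))
    rw [List.append_assoc, List.cons_append, List.cons_append, this, pathLen_cons2]
    linarith

theorem HW.mono {E : Type*} [PseudoMetricSpace E] {a b : E} {A A' : Set E} {c c' : ℝ}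
    (h : HW a b A c) (hA : A' ⊆ A) (hc : c ≤ c') : HW a b A' c' := by
  obtain ⟨l, h1, h2⟩ := h
  exact ⟨l, fun x hx => h1 x (hA hx), h2.trans hc⟩

theorem HW.edge {E : Type*} [PseudoMetricSpace E] (a b : E) : HW a b {a, b} (dist a b) :=
  ⟨[], by simp, by simp [pathLen]⟩

inductive Coll {E : Type*} [PseudoMetricSpace E] : List E → Set E → ℝ → Prop
  | nil : Coll [] ∅ 0
  | cons {a b : E} {A B : Set E} {c c' : ℝ} {z : List E} (h : HW a b A c) (h' : Coll z B c') :
      Coll (a :: b :: z) (A ∪ B) (c + c')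

theorem Coll.extract {E : Type*} [PseudoMetricSpace E] {y : List E} {A : Set E} {c : ℝ}
    (h : Coll y A c) : ∀ (p : E) (z : List E), y.Perm (p :: z) →
      ∃ b y' A₁ A₂ c₁ c₂, HW p b A₁ c₁ ∧ Coll y' A₂ c₂ ∧ z.Perm (b :: y') ∧
        A = A₁ ∪ A₂ ∧ c = c₁ + c₂ := by
  classical
  induction h with
  | nil => intro p z h; simp at h
  | @cons a b A B c c' y hw hc ih =>
    intro p z h
    by_cases hpa : p = a
    · subst hpa
      exact ⟨b, y, A, B, c, c', hw, hc, ((List.perm_cons _).1 h).symm, rfl, rfl⟩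
    by_cases hpb : p = b
    · subst hpb
      refine ⟨a, y, A, B, c, c', hw.symm, hc, ?_, rfl, rfl⟩
      exact ((List.perm_cons _).1 ((List.Perm.swap _ _ _).trans h)).symm
    have hp : p ∈ y := by
      have : p ∈ a :: b :: y := h.symm.subset (by simp)
      simpa [hpa, hpb] using this
    obtain ⟨b', y', A₁, A₂, c₁, c₂, h1, h2, h3, rfl, rfl⟩ := ih p (y.erase p) (List.perm_cons_erase hp)
    refine ⟨b', a :: b :: y', A₁, A ∪ A₂, c₁, c + c₂, h1, .cons hw h2, ?_, ?_, by ring⟩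
    · have h4 : (p :: z).Perm (p :: a :: b :: y.erase p) := by
        refine h.symm.trans ?_
        have := List.perm_cons_erase hp
        refine ((this.cons b).cons a).trans ?_
        exact ((List.Perm.swap _ _ _).cons a).trans (List.Perm.swap _ _ _)
      have h5 := (List.perm_cons _).1 h4
      refine h5.trans (((h3.cons b).cons a).trans ?_)
      exact ((List.Perm.swap _ _ _).cons a).trans (List.Perm.swap _ _ _)
    · ext x; simp; tauto

theorem Coll.join {E : Type*} [PseudoMetricSpace E] (n : ℕ) : ∀ (z y : List E) (A : Set E) (c : ℝ),
    z.length ≤ n → Coll y A c → y.Perm z →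
    ∃ w : List E, (∀ x ∈ A, x ∈ w) ∧ pathLen dist w ≤ c + 2 * pathLen dist z := by
  classical
  induction n with
  | zero =>
    intro z y A c hn h hp
    have hz : z = [] := by simpa using hn
    subst hz
    have hy : y = [] := by simpa using hp
    subst hy
    cases h
    exact ⟨[], by simp, by simp [pathLen]⟩
  | succ n ih =>
    intro z y A c hn h hp
    have nn : ∀ l : List E, 0 ≤ pathLen dist l := pathLen_nonneg' _ (fun _ _ => dist_nonneg)
    cases z with
    | nil => exact ih [] y A c (by simp) h hp
    | cons z₁ z =>
    obtain ⟨b₁, y₁, A₁, A₂, c₁, c₂, hW, hC, hp₁, rfl, rfl⟩ := h.extract z₁ z hp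
    cases z with
    | nil => simp at hp₁
    | cons z₂ z =>
    by_cases hb : b₁ = z₂
    · subst hb
      have hp₂ := (List.perm_cons _).1 hp₁
      cases z with
      | nil =>
        have hy : y₁ = [] := by simpa using hp₂
        subst hy
        cases hC
        obtain ⟨l, h1, h2⟩ := hW
        refine ⟨z₁ :: (l ++ [b₁]), fun x hx => h1 x (by simpa using hx), ?_⟩
        linarith [nn [z₁, b₁]]
      | cons z₃ z =>
        obtain ⟨b₃, y₃, A₃, A₄, c₃, c₄, hW₃, hC₃, hp₃, rfl, rfl⟩ := hC.extract z₃ z hp₂.symm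
        have hW' := ((HW.edge z₃ z₃).trans hW.symm).trans hW₃
        obtain ⟨w, hw1, hw2⟩ := ih (z₃ :: z) _ _ _ (by simp at hn ⊢; omega) (Coll.cons hW' hC₃)
          (hp₃.symm.cons z₃)
        refine ⟨w, ?_, hw2.trans ?_⟩
        · intro x hx
          apply hw1
          simp at hx ⊢; tauto
        · rw [pathLen_cons2, pathLen_cons2, dist_self, dist_comm z₃ b₁]
          linarith [dist_triangle z₁ b₁ z₃, dist_nonneg (x := z₁) (y := b₁)]
    · have hz₂ : z₂ ∈ y₁ := by
        have : z₂ ∈ b₁ :: y₁ := hp₁.subset (by simp)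
        simpa [Ne.symm hb] using this
      obtain ⟨b₂, y₂, A₃, A₄, c₃, c₄, hW₃, hC₃, hp₃, rfl, rfl⟩ :=
        hC.extract z₂ (y₁.erase z₂) (List.perm_cons_erase hz₂)
      have hW' := hW.symm.trans hW₃
      have hp₄ : z.Perm (b₁ :: b₂ :: y₂) := by
        have := hp₁.trans ((List.perm_cons_erase hz₂).cons b₁)
        have := (List.perm_cons _).1 (this.trans (List.Perm.swap _ _ _))
        exact this.trans (hp₃.cons b₁)
      obtain ⟨w, hw1, hw2⟩ := ih z _ _ _ (by simp at hn ⊢; omega) (Coll.cons hW' hC₃) hp₄.symm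
      refine ⟨w, ?_, hw2.trans ?_⟩
      · intro x hx
        apply hw1
        simp at hx ⊢; tauto
      · rw [pathLen_cons2]
        linarith [pathLen_le_cons dist (fun _ _ => dist_nonneg) z₂ z,
          dist_nonneg (x := z₁) (y := z₂)]

/-- partial L1 distance -/
def rhoS {d : ℕ} (s : Finset (Fin d)) (x y : EuclideanSpace ℝ (Fin d)) : ℝ :=
  ∑ i ∈ s, |x i - y i|

theorem rhoS_nonneg {d : ℕ} (s : Finset (Fin d)) (x y : EuclideanSpace ℝ (Fin d)) :
    0 ≤ rhoS s x y := Finset.sum_nonneg fun _ _ => abs_nonneg _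

theorem rhoS_le {d : ℕ} (s : Finset (Fin d)) (x y : EuclideanSpace ℝ (Fin d))
    (hx : x ∈ unitCube d) (hy : y ∈ unitCube d) : rhoS s x y ≤ s.card := by
  unfold rhoS
  have : ∀ i ∈ s, |x i - y i| ≤ 1 := fun i _ => by
    have h1 := hx i; have h2 := hy i
    rw [abs_le]; constructor <;> linarith [h1.1, h1.2, h2.1, h2.2]
  simpa using Finset.sum_le_card_nsmul s _ 1 this

theorem dist_le_rho {d : ℕ} (x y : EuclideanSpace ℝ (Fin d)) :
    dist x y ≤ rhoS Finset.univ x y := by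
  rw [EuclideanSpace.dist_eq]
  apply Real.sqrt_le_iff.2 ⟨rhoS_nonneg _ _ _, ?_⟩
  simp only [Real.dist_eq]
  unfold rhoS
  exact Finset.sum_sq_le_sq_sum_of_nonneg fun _ _ => abs_nonneg _

theorem sorted_pathLen {d : ℕ} (i : Fin d) (l : List (EuclideanSpace ℝ (Fin d))) :
    ∀ a, (a :: l).Pairwise (fun x y => x i ≤ y i) → (∀ x ∈ a :: l, x i ≤ 1) →
    pathLen (rhoS {i}) (a :: l) ≤ 1 - a i := by
  induction l with
  | nil => intro a _ h; simp [pathLen]; exact h a (by simp)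
  | cons b l ih =>
    intro a hp h
    rw [pathLen_cons2]
    have h1 := ih b (List.Pairwise.of_cons hp) (fun x hx => h x (List.mem_cons_of_mem _ hx))
    have h2 : a i ≤ b i := (List.pairwise_cons.1 hp).1 b (by simp)
    have h3 : rhoS {i} a b = b i - a i := by
      simp [rhoS]; rw [abs_sub_comm, abs_of_nonneg]; linarith
    linarith

theorem strip {d : ℕ} (s : Finset (Fin d)) (hs : s.Nonempty) :
    ∃ c : ℝ, 0 ≤ c ∧ ∀ N : ℕ, 1 ≤ N → ∀ l : List (EuclideanSpace ℝ (Fin d)),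
      (∀ x ∈ l, x ∈ unitCube d) → ∃ l', l.Perm l' ∧
        pathLen (rhoS s) l' ≤ c * ((N:ℝ) ^ (s.card - 1) + l.length / N) := by
  classical
  induction hs using Finset.Nonempty.cons_induction with
  | singleton i =>
    refine ⟨1, zero_le_one, fun N hN l hl => ?_⟩
    let r : EuclideanSpace ℝ (Fin d) → EuclideanSpace ℝ (Fin d) → Prop := fun x y => x i ≤ y i
    have : Std.Total r := ⟨fun x y => le_total (x i) (y i)⟩
    have : IsTrans _ r := ⟨fun x y z h h' => le_trans (α := ℝ) h h'⟩
    refine ⟨l.insertionSort r, (List.perm_insertionSort r l).symm, ?_⟩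
    have h1 : pathLen (rhoS {i}) (l.insertionSort r) ≤ 1 := by
      have hp := List.pairwise_insertionSort r l
      have hm : ∀ x ∈ l.insertionSort r, x ∈ unitCube d := fun x hx =>
        hl x ((List.perm_insertionSort r l).subset hx)
      revert hp hm
      generalize l.insertionSort r = q
      intro hp hm
      cases q with
      | nil => simp [pathLen]
      | cons a q =>
        have := sorted_pathLen i q a hp (fun x hx => (hm x hx i).2)
        linarith [(hm a (by simp) i).1]
    have : (0:ℝ) ≤ l.length / N := by positivity
    simp
    linarith
  | cons i s hi hs ih =>
    obtain ⟨c, hc, ih⟩ := ih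
    refine ⟨2 * c + 1 + 2 * (s.card + 1), by positivity, fun N hN l hl => ?_⟩
    have hN0 : (0:ℝ) < N := by exact_mod_cast hN
    have key : ∀ j : ℕ, ∀ l : List (EuclideanSpace ℝ (Fin d)), (∀ x ∈ l, x ∈ unitCube d) →
        (∀ x ∈ l, x i < j / N) → ∃ l', l.Perm l' ∧ pathLen (rhoS (Finset.cons i s hi)) l' ≤
          j * (c * (N:ℝ) ^ (s.card - 1) + (s.card + 1)) + (c + 1) * l.length / N := by
      intro j
      induction j with
      | zero =>
        intro l hl hj
        have : l = [] := by
          rw [List.eq_nil_iff_forall_not_mem]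
          intro x hx
          have := hj x hx
          simp at this
          linarith [(hl x hx i).1]
        subst this
        exact ⟨[], List.Perm.refl _, by simp [pathLen]⟩
      | succ j ihj =>
        intro l hl hj
        set l₁ := l.filter (fun x => decide (x i < (j:ℝ) / N)) with hl₁
        set l₂ := l.filter (fun x => !decide (x i < (j:ℝ) / N)) with hl₂
        have hperm : (l₁ ++ l₂).Perm l := List.filter_append_perm _ _
        obtain ⟨q₁, hq₁, hb₁⟩ := ihj l₁ (fun x hx => hl x (List.mem_filter.1 hx).1)
          (fun x hx => by simpa using (List.mem_filter.1 hx).2)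
        obtain ⟨q₂, hq₂, hb₂⟩ := ih N hN l₂ (fun x hx => hl x (List.mem_filter.1 hx).1)
        have hlen : (l.length : ℝ) = l₁.length + l₂.length := by
          rw [← hperm.length_eq]; simp
        refine ⟨q₁ ++ q₂, hperm.symm.trans (hq₁.append hq₂), ?_⟩
        have hq₂m : ∀ x ∈ q₂, x ∈ l ∧ (j:ℝ) / N ≤ x i := fun x hx => by
          have := List.mem_filter.1 (hq₂.symm.subset hx)
          simpa using this
        have h2 : pathLen (rhoS (Finset.cons i s hi)) q₂ ≤
            pathLen (rhoS s) q₂ + q₂.length * (1 / N) := by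
          apply pathLen_le_add _ _ _ (by positivity)
          intro x hx y hy
          have e : rhoS (Finset.cons i s hi) x y = |x i - y i| + rhoS s x y := by
            unfold rhoS; rw [Finset.sum_cons]
          have hx1 := (hq₂m x hx).2
          have hy1 := (hq₂m y hy).2
          have hx2 := hj x (hq₂m x hx).1
          have hy2 := hj y (hq₂m y hy).1
          push_cast at hx2 hy2
          rw [add_div] at hx2 hy2
          have : |x i - y i| ≤ 1 / N := by
            rw [abs_le]; constructor <;> linarith
          linarith
        have h3 := pathLen_append_le (rhoS (Finset.cons i s hi)) (s.card + 1) (by positivity) q₁ q₂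
          (fun x hx y hy => by
            have := rhoS_le (Finset.cons i s hi) x y
              (hl x (List.mem_filter.1 (hq₁.symm.subset hx)).1) (hl y (hq₂m y hy).1)
            rw [Finset.card_cons] at this; exact_mod_cast this)
        rw [← hq₂.length_eq] at h2
        rw [hlen]
        push_cast
        refine h3.trans ?_
        have e1 : (c + 1) * ((l₁.length:ℝ) + l₂.length) / N =
          (c + 1) * (l₁.length:ℝ) / N + (c * (l₂.length / N) + l₂.length * (1 / N)) := by
          ring
        rw [e1]
        rw [mul_add] at hb₂
        linarith
    obtain ⟨l', hp, hb⟩ := key (N + 1) l hl (fun x hx => by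
      have := (hl x hx i).2
      refine this.trans_lt ?_
      rw [lt_div_iff₀ hN0]; push_cast; linarith)
    refine ⟨l', hp, hb.trans ?_⟩
    have hcard : (Finset.cons i s hi).card - 1 = (s.card - 1) + 1 := by
      have := hs.card_pos
      rw [Finset.card_cons]; omega
    rw [hcard, pow_succ]
    set P := (N:ℝ) ^ (s.card - 1) with hP
    have hN1 : (1:ℝ) ≤ N := by exact_mod_cast hN
    have hP1 : 1 ≤ P := one_le_pow₀ hN1
    have hX : (0:ℝ) ≤ l.length / N := by positivity
    have e2 : (c + 1) * (l.length:ℝ) / N = (c + 1) * (l.length / N) := by ring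
    rw [e2]
    set X := (l.length:ℝ) / N
    set K := (s.card : ℝ) + 1 with hK
    have hK0 : 0 ≤ K := by positivity
    push_cast
    have h1 : ((N:ℝ) + 1) * (c * P + K) ≤ (2 * N) * (c * P + K * P) := by
      have : K ≤ K * P := le_mul_of_one_le_right hK0 hP1
      gcongr
      linarith
    have h2 : 0 ≤ (P * N) := by positivity
    nlinarith [mul_nonneg hc hX, mul_nonneg hK0 hX]

theorem crossing_aux {d : ℕ} (i : Fin d) (t : ℝ) (x y : EuclideanSpace ℝ (Fin d))
    (hx : x ∈ unitCube d) (hy : y ∈ unitCube d) (h1 : x i < t) (h2 : t ≤ y i) :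
    ∃ p ∈ unitCube d, p i = t ∧ dist x p + dist p y = dist x y := by
  have h3 : 0 < y i - x i := by linarith
  set θ := (t - x i) / (y i - x i) with hθ
  have hθ0 : 0 ≤ θ := div_nonneg (by linarith) h3.le
  have hθ1 : θ ≤ 1 := by rw [hθ, div_le_one h3]; linarith
  have hc : ∀ k, (AffineMap.lineMap x y θ : EuclideanSpace ℝ (Fin d)) k
      = (1 - θ) * x k + θ * y k := by
    intro k
    simp [AffineMap.lineMap_apply]; ring
  refine ⟨AffineMap.lineMap x y θ, ?_, ?_, ?_⟩
  · intro k
    rw [hc]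
    have hxk := hx k
    have hyk := hy k
    constructor
    · have := mul_nonneg (sub_nonneg.2 hθ1) hxk.1
      have := mul_nonneg hθ0 hyk.1
      linarith
    · have := mul_le_mul_of_nonneg_left hxk.2 (sub_nonneg.2 hθ1)
      have := mul_le_mul_of_nonneg_left hyk.2 hθ0
      linarith
  · rw [hc]
    have : θ * (y i - x i) = t - x i := div_mul_cancel₀ _ h3.ne'
    linarith
  · rw [dist_add_dist_eq_iff]
    exact ⟨θ, ⟨hθ0, hθ1⟩, rfl⟩

theorem crossing {d : ℕ} (i : Fin d) (t : ℝ) (x y : EuclideanSpace ℝ (Fin d))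
    (hx : x ∈ unitCube d) (hy : y ∈ unitCube d) (h : ¬ (x i < t ↔ y i < t)) :
    ∃ p ∈ unitCube d, p i = t ∧ dist x p + dist p y = dist x y := by
  by_cases h1 : x i < t
  · have h2 : ¬ (y i < t) := by tauto
    exact crossing_aux i t x y hx hy h1 (not_lt.1 h2)
  · have h2 : y i < t := by tauto
    obtain ⟨p, hp, hpt, hd⟩ := crossing_aux i t y x hy hx h2 (not_lt.1 h1)
    refine ⟨p, hp, hpt, ?_⟩
    rw [dist_comm x p, dist_comm p y, dist_comm x y]; linarith

theorem exists_proj {d : ℕ} (i : Fin d) (t : ℝ) (ht : t ∈ Set.Icc (0:ℝ) 1)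
    (x : EuclideanSpace ℝ (Fin d)) (hx : x ∈ unitCube d) :
    ∃ p ∈ unitCube d, p i = t ∧ dist x p ≤ 1 := by
  refine ⟨WithLp.toLp 2 (Function.update (fun k => x k) i t), ?_, by simp, ?_⟩
  · intro k
    by_cases hk : k = i
    · subst hk; simpa using ht
    · simpa [hk] using hx k
  · refine (dist_le_rho _ _).trans ?_
    unfold rhoS
    rw [Finset.sum_eq_single i]
    · have := hx i
      simp
      rw [abs_le]; constructor <;> linarith [this.1, this.2, ht.1, ht.2]
    · intro k _ hk; simp [hk]
    · simp

theorem sweep {d : ℕ} (i : Fin d) (t : ℝ) (ht : t ∈ Set.Icc (0:ℝ) 1)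
    (l : List (EuclideanSpace ℝ (Fin d))) : ∀ x, (∀ p ∈ x :: l, p ∈ unitCube d) →
    ∃ b A c z₁ A₁ c₁ z₂ A₂ c₂, HW x b A c ∧ Coll z₁ A₁ c₁ ∧ Coll z₂ A₂ c₂ ∧
      (b ∈ unitCube d ∧ b i = t) ∧ (∀ p ∈ z₁, p ∈ unitCube d ∧ p i = t) ∧
      (∀ p ∈ z₂, p ∈ unitCube d ∧ p i = t) ∧
      (∀ p ∈ x :: l, (p i < t ↔ x i < t) → p ∈ A ∪ A₁) ∧
      (∀ p ∈ x :: l, ¬ (p i < t ↔ x i < t) → p ∈ A₂) ∧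
      c + c₁ + c₂ ≤ pathLen dist (x :: l) + 1 ∧
      z₁.length ≤ 2 * l.length ∧ z₂.length ≤ 2 * l.length := by
  induction l with
  | nil =>
    intro x hx
    obtain ⟨b, hb, hbt, hd⟩ := exists_proj i t ht x (hx x (by simp))
    refine ⟨b, {x, b}, dist x b, [], ∅, 0, [], ∅, 0, HW.edge x b, .nil, .nil, ⟨hb, hbt⟩,
      by simp, by simp, by simp, by simp, ?_, by simp, by simp⟩
    rw [pathLen_single]; linarith
  | cons x l ih =>
    intro x' hx
    obtain ⟨b, A, c, z₁, A₁, c₁, z₂, A₂, c₂, hW, hC₁, hC₂, hb, hz₁, hz₂, hA₁, hA₂, hc, hl₁, hl₂⟩ :=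
      ih x (fun p hp => hx p (List.mem_cons_of_mem _ hp))
    by_cases hs : (x' i < t ↔ x i < t)
    · refine ⟨b, {x', x'} ∪ A, dist x' x' + dist x' x + c, z₁, A₁, c₁, z₂, A₂, c₂,
        (HW.edge x' x').trans hW, hC₁, hC₂, hb, hz₁, hz₂, ?_, ?_, ?_, ?_, ?_⟩
      · intro p hp hpx
        rcases List.mem_cons.1 hp with rfl | hp
        · simp
        · have := hA₁ p hp (hpx.trans hs)
          simp at this ⊢; tauto
      · intro p hp hpx
        rcases List.mem_cons.1 hp with rfl | hp
        · simp at hpx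
        · exact hA₂ p hp (fun h => hpx (h.trans hs.symm))
      · rw [pathLen_cons2, dist_self]; linarith
      · simp; omega
      · simp; omega
    · obtain ⟨y, hy, hyt, hd⟩ := crossing i t x' x (hx x' (by simp)) (hx x (by simp)) hs
      refine ⟨y, {x', y}, dist x' y, z₂, A₂, c₂, y :: b :: z₁, ({y, y} ∪ A) ∪ A₁,
        (dist y y + dist y x + c) + c₁, HW.edge x' y, hC₂, .cons ((HW.edge y y).trans hW) hC₁,
        ⟨hy, hyt⟩, hz₂, ?_, ?_, ?_, ?_, ?_, ?_⟩
      · intro p hp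
        rcases List.mem_cons.1 hp with rfl | hp
        · exact ⟨hy, hyt⟩
        rcases List.mem_cons.1 hp with rfl | hp
        · exact hb
        · exact hz₁ p hp
      · intro p hp hpx
        rcases List.mem_cons.1 hp with rfl | hp
        · simp
        · exact Or.inr (hA₂ p hp (fun h => hs (hpx.symm.trans h)))
      · intro p hp hpx
        rcases List.mem_cons.1 hp with rfl | hp
        · simp at hpx
        · have := hA₁ p hp (by tauto)
          simp at this ⊢; tauto
      · rw [pathLen_cons2, dist_self]; linarith
      · simp; omega
      · simp; omega

theorem two_split {d : ℕ} (hd : 2 ≤ d) (i : Fin d) : ∃ c : ℝ, 0 ≤ c ∧ ∀ N : ℕ, 1 ≤ N →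
    ∀ t ∈ Set.Icc (0:ℝ) 1, ∀ n : ℕ, ∀ G : Set (EuclideanSpace ℝ (Fin d)), G.Finite → G ⊆ unitCube d →
    G.ncard ≤ n →
    T (G ∩ {x | x i < t}) + T (G ∩ {x | ¬ x i < t}) ≤
      T G + (2 + c * ((N:ℝ) ^ (d - 2) + (2 * n : ℕ) / N)) := by
  classical
  have hcard : (Finset.univ.erase i : Finset (Fin d)).card = d - 1 := by
    rw [Finset.card_erase_of_mem (Finset.mem_univ i)]; simp
  have hne : (Finset.univ.erase i : Finset (Fin d)).Nonempty := by
    rw [← Finset.card_pos, hcard]; omega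
  obtain ⟨c, hc, hstrip⟩ := strip (Finset.univ.erase i) hne
  refine ⟨4 * c, by positivity, ?_⟩
  intro N hN t ht n G hG hGc hn
  rw [hcard, show d - 1 - 1 = d - 2 by omega] at hstrip
  have hN0 : (0:ℝ) < N := by exact_mod_cast hN
  set Q := (N:ℝ) ^ (d - 2) + (2 * n : ℕ) / N with hQ
  have hQ0 : 0 ≤ Q := by positivity
  have key : ∀ (z : List (EuclideanSpace ℝ (Fin d))) (A : Set (EuclideanSpace ℝ (Fin d))) (e : ℝ),
      (∀ p ∈ z, p ∈ unitCube d ∧ p i = t) → z.length ≤ 2 * n → Coll z A e →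
      ∀ B ⊆ A, T B ≤ e + 2 * (c * Q) := by
    intro z A e hz hlen hC B hB
    obtain ⟨z', hp, hb⟩ := hstrip N hN z (fun p hp => (hz p hp).1)
    obtain ⟨w, hw, hwl⟩ := Coll.join z'.length z' z A e le_rfl hC hp
    refine (T_le B w (fun x hx => hw x (hB hx))).trans (hwl.trans ?_)
    have h1 : pathLen dist z' ≤ pathLen (rhoS (Finset.univ.erase i)) z' + z'.length * 0 := by
      apply pathLen_le_add _ _ _ le_rfl
      intro x hx y hy
      refine (dist_le_rho x y).trans ?_
      have h1 := (hz x (hp.symm.subset hx)).2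
      have h2 := (hz y (hp.symm.subset hy)).2
      unfold rhoS
      rw [← Finset.add_sum_erase _ _ (Finset.mem_univ i), h1, h2]
      simp
    have h2 : c * ((N:ℝ) ^ (d - 2) + z.length / N) ≤ c * Q := by
      rw [hQ]
      have : (z.length : ℝ) ≤ (2 * n : ℕ) := by exact_mod_cast hlen
      gcongr
    linarith
  suffices h : T (G ∩ {x | x i < t}) + T (G ∩ {x | ¬ x i < t}) - (2 + 4 * c * Q) ≤ T G by linarith
  refine le_T G hG _ ?_
  intro l hl
  have hcQ : 0 ≤ c * Q := mul_nonneg hc hQ0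
  cases l with
  | nil =>
    have hGe : G = ∅ := by
      ext x; rw [← hl.2 x]; simp
    subst hGe
    simp only [Set.empty_inter, T_empty, pathLen_nil']
    linarith
  | cons x l =>
    have hcube : ∀ p ∈ x :: l, p ∈ unitCube d := fun p hp => hGc ((hl.2 p).1 hp)
    have hlen : l.length + 1 ≤ n := by
      refine le_trans ?_ hn
      have : G = ((x :: l).toFinset : Set _) := by
        ext y; rw [← hl.2 y]; simp
      rw [this, Set.ncard_coe_finset, List.toFinset_card_of_nodup hl.1]
      simp
    obtain ⟨b, A, c', z₁, A₁, c₁, z₂, A₂, c₂, hW, hC₁, hC₂, hb, hz₁, hz₂, hA₁, hA₂, hc', hl₁, hl₂⟩ :=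
      sweep i t ht l x hcube
    obtain ⟨y, hy, hyt, hyd⟩ := exists_proj i t ht x (hcube x (by simp))
    have hC := Coll.cons ((HW.edge y y).trans hW) hC₁
    have k1 := key _ _ _ (by
      intro p hp
      rcases List.mem_cons.1 hp with rfl | hp
      · exact ⟨hy, hyt⟩
      rcases List.mem_cons.1 hp with rfl | hp
      · exact hb
      · exact hz₁ p hp) (by simp; omega) hC
    have k2 := key _ _ _ hz₂ (by omega) hC₂
    rw [dist_self, dist_comm y x] at k1
    by_cases hx : x i < t
    · have m1 := k1 (G ∩ {x | x i < t}) (by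
        rintro p ⟨hp, hpt⟩
        have := hA₁ p ((hl.2 p).2 hp) (by simp only [Set.mem_ofPred_eq] at hpt; tauto)
        simp at this ⊢; tauto)
      have m2 := k2 (G ∩ {x | ¬ x i < t}) (by
        rintro p ⟨hp, hpt⟩
        exact hA₂ p ((hl.2 p).2 hp) (by simp only [Set.mem_ofPred_eq] at hpt; tauto))
      linarith
    · have m1 := k1 (G ∩ {x | ¬ x i < t}) (by
        rintro p ⟨hp, hpt⟩
        have := hA₁ p ((hl.2 p).2 hp) (by simp only [Set.mem_ofPred_eq] at hpt; tauto)
        simp at this ⊢; tauto)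
      have m2 := k2 (G ∩ {x | x i < t}) (by
        rintro p ⟨hp, hpt⟩
        exact hA₂ p ((hl.2 p).2 hp) (by simp only [Set.mem_ofPred_eq] at hpt; tauto))
      linarith

def lab (m : ℕ) (u : ℝ) : ℕ := min ⌊(m:ℝ) * u⌋₊ (m - 1)

def SplitsBy {d : ℕ} {α : Type} [Fintype α] (n : ℕ) (e : ℝ)
    (g : EuclideanSpace ℝ (Fin d) → α) : Prop :=
  ∀ G : Set (EuclideanSpace ℝ (Fin d)), G.Finite → G ⊆ unitCube d → G.ncard ≤ n →
    ∑ a, T (G ∩ {x | g x = a}) ≤ T G + e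

theorem slabs {d : ℕ} (i : Fin d) (n : ℕ) (e : ℝ) (m : ℕ) (hm : 1 ≤ m)
    (H : ∀ t ∈ Set.Icc (0:ℝ) 1, ∀ G : Set (EuclideanSpace ℝ (Fin d)), G.Finite → G ⊆ unitCube d →
      G.ncard ≤ n → T (G ∩ {x | x i < t}) + T (G ∩ {x | ¬ x i < t}) ≤ T G + e)
    (G : Set (EuclideanSpace ℝ (Fin d))) (hG : G.Finite) (hGc : G ⊆ unitCube d)
    (hn : G.ncard ≤ n) (K : ℕ) (hK : K ≤ m - 1) :
    ∑ k ∈ Finset.range K, T (G ∩ {x | lab m (x i) = k}) + T (G ∩ {x | K ≤ lab m (x i)})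
      ≤ T G + K * e := by
  have hm0 : (0:ℝ) < m := by exact_mod_cast hm
  induction K with
  | zero => simp
  | succ K ih =>
    have ih := ih (by omega)
    have hsub : G ∩ {x | K ≤ lab m (x i)} ⊆ G := Set.inter_subset_left
    have h1 := H (((K + 1 : ℕ) : ℝ) / m) ⟨by positivity, by
        rw [div_le_one hm0]; exact_mod_cast (by omega : K + 1 ≤ m)⟩
      (G ∩ {x | K ≤ lab m (x i)}) (hG.subset hsub) (hsub.trans hGc)
      ((Set.ncard_le_ncard hsub hG).trans hn)
    have hlab : ∀ x ∈ G, (x i < ((K + 1 : ℕ) : ℝ) / m ↔ lab m (x i) < K + 1) := by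
      intro x hx
      have h0 : 0 ≤ (m:ℝ) * x i := mul_nonneg hm0.le (hGc hx i).1
      have h2 : lab m (x i) < K + 1 ↔ ⌊(m:ℝ) * x i⌋₊ < K + 1 := by
        unfold lab; omega
      rw [h2, Nat.floor_lt h0, lt_div_iff₀ hm0, mul_comm]
    have e1 : G ∩ {x | K ≤ lab m (x i)} ∩ {x | x i < ((K + 1 : ℕ) : ℝ) / m}
        = G ∩ {x | lab m (x i) = K} := by
      ext x
      simp only [Set.mem_inter_iff, Set.mem_ofPred_eq]
      constructor
      · rintro ⟨⟨h, h'⟩, h''⟩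
        have := (hlab x h).1 h''
        exact ⟨h, by omega⟩
      · rintro ⟨h, h'⟩
        exact ⟨⟨h, by omega⟩, (hlab x h).2 (by omega)⟩
    have e2 : G ∩ {x | K ≤ lab m (x i)} ∩ {x | ¬ x i < ((K + 1 : ℕ) : ℝ) / m}
        = G ∩ {x | K + 1 ≤ lab m (x i)} := by
      ext x
      simp only [Set.mem_inter_iff, Set.mem_ofPred_eq]
      constructor
      · rintro ⟨⟨h, h'⟩, h''⟩
        have : ¬ lab m (x i) < K + 1 := fun h3 => h'' ((hlab x h).2 h3)
        exact ⟨h, by omega⟩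
      · rintro ⟨h, h'⟩
        refine ⟨⟨h, by omega⟩, fun h3 => ?_⟩
        have := (hlab x h).1 h3
        omega
    rw [e1, e2] at h1
    rw [Finset.sum_range_succ]
    push_cast
    linarith

theorem lab_lt (m : ℕ) (hm : 1 ≤ m) (u : ℝ) : lab m u < m := by unfold lab; omega

theorem slabs_split {d : ℕ} (i : Fin d) (n : ℕ) (e : ℝ) (he : 0 ≤ e) (m : ℕ) (hm : 1 ≤ m)
    (H : ∀ t ∈ Set.Icc (0:ℝ) 1, ∀ G : Set (EuclideanSpace ℝ (Fin d)), G.Finite → G ⊆ unitCube d →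
      G.ncard ≤ n → T (G ∩ {x | x i < t}) + T (G ∩ {x | ¬ x i < t}) ≤ T G + e) :
    SplitsBy n (m * e) (fun x : EuclideanSpace ℝ (Fin d) => (⟨lab m (x i), lab_lt m hm _⟩ : Fin m)) := by
  intro G hG hGc hn
  have h := slabs i n e m hm H G hG hGc hn (m - 1) le_rfl
  have e1 : ∑ a : Fin m, T (G ∩ {x | (⟨lab m (x i), lab_lt m hm _⟩ : Fin m) = a})
      = ∑ k ∈ Finset.range m, T (G ∩ {x | lab m (x i) = k}) := by
    rw [Finset.sum_range]
    refine Finset.sum_congr rfl fun a _ => ?_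
    simp only [Fin.ext_iff]
  rw [e1]
  have e2 : Finset.range m = Finset.range ((m - 1) + 1) := by congr 1; omega
  rw [e2, Finset.sum_range_succ]
  have e3 : G ∩ {x | m - 1 ≤ lab m (x i)} = G ∩ {x | lab m (x i) = m - 1} := by
    ext x
    have := lab_lt m hm (x i)
    simp only [Set.mem_inter_iff, Set.mem_ofPred_eq]
    constructor <;> rintro ⟨h1, h2⟩ <;> exact ⟨h1, by omega⟩
  rw [e3] at h
  have : ((m - 1 : ℕ) : ℝ) * e ≤ m * e := by
    gcongr; omega
  linarith

theorem splits_pi {d : ℕ} {β : Type} [Fintype β] (j : ℕ) : ∃ a : ℝ, 0 ≤ a ∧ ∀ (n : ℕ) (e : ℝ),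
    0 ≤ e → ∀ f : Fin j → EuclideanSpace ℝ (Fin d) → β, (∀ r, SplitsBy n e (f r)) →
    SplitsBy n (a * e) (fun x => fun r => f r x) := by
  induction j with
  | zero =>
    refine ⟨0, le_rfl, fun n e he f _ G hG hGc hn => ?_⟩
    simp only [Finset.univ_unique, Finset.sum_singleton, zero_mul, add_zero]
    refine le_of_eq ?_
    congr 1
    ext x
    simp only [Set.mem_inter_iff, Set.mem_ofPred_eq, and_iff_left_iff_imp]
    intro _
    exact Subsingleton.elim _ _
  | succ j ih =>
    obtain ⟨a, ha, ih⟩ := ih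
    refine ⟨1 + Fintype.card β * a, by positivity, fun n e he f hf G hG hGc hn => ?_⟩
    have h0 := hf 0 G hG hGc hn
    have h1 := ih n e he (fun r => f r.succ) (fun r => hf r.succ)
    rw [← (Fin.consEquiv (fun _ : Fin (j + 1) => β)).sum_comp, Fintype.sum_prod_type]
    have h2 : ∀ b : β, ∑ q : Fin j → β,
        T (G ∩ {x | (fun r => f r x) = (Fin.consEquiv (fun _ : Fin (j + 1) => β)) (b, q)}) ≤
        T (G ∩ {x | f 0 x = b}) + a * e := by
      intro b
      have hsub : G ∩ {x | f 0 x = b} ⊆ G := Set.inter_subset_left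
      refine le_trans (le_of_eq ?_) (h1 (G ∩ {x | f 0 x = b}) (hG.subset hsub) (hsub.trans hGc)
        ((Set.ncard_le_ncard hsub hG).trans hn))
      refine Finset.sum_congr rfl fun q _ => ?_
      congr 1
      ext x
      simp only [Set.mem_inter_iff, Set.mem_ofPred_eq, and_assoc]
      refine and_congr_right fun _ => ?_
      constructor
      · intro h
        refine ⟨by simpa using congrFun h 0, ?_⟩
        funext r
        simpa using congrFun h r.succ
      · rintro ⟨h, h'⟩
        funext r
        refine Fin.cases ?_ (fun r => ?_) r
        · simpa using h
        · simpa using congrFun h' r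
    refine (Finset.sum_le_sum fun b _ => h2 b).trans ?_
    rw [Finset.sum_add_distrib]
    simp only [Finset.sum_const, Finset.card_univ, nsmul_eq_mul]
    linarith

theorem T_union_le {d : ℕ} (A B : Set (EuclideanSpace ℝ (Fin d))) (hA : A.Finite) (hB : B.Finite)
    (hAc : A ⊆ unitCube d) (hBc : B ⊆ unitCube d) : T (A ∪ B) ≤ T A + T B + d := by
  suffices h : T (A ∪ B) - T B - d ≤ T A by linarith
  refine le_T A hA _ fun l₁ hl₁ => ?_
  suffices h : T (A ∪ B) - pathLen dist l₁ - d ≤ T B by linarith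
  refine le_T B hB _ fun l₂ hl₂ => ?_
  have h1 := T_le (A ∪ B) (l₁ ++ l₂) (by
    rintro x (hx | hx)
    · exact List.mem_append_left _ ((hl₁.2 x).2 hx)
    · exact List.mem_append_right _ ((hl₂.2 x).2 hx))
  have h2 := pathLen_append_le (dist : EuclideanSpace ℝ (Fin d) → _ → ℝ) d (by positivity) l₁ l₂
    (fun x hx y hy => by
      have := rhoS_le Finset.univ x y (hAc ((hl₁.2 x).1 hx)) (hBc ((hl₂.2 y).1 hy))
      simp only [Finset.card_univ, Fintype.card_fin] at this
      exact (dist_le_rho x y).trans this)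
  linarith

theorem T_le_sum {d : ℕ} {α : Type} [Fintype α] (g : EuclideanSpace ℝ (Fin d) → α)
    (G : Set (EuclideanSpace ℝ (Fin d))) (hG : G.Finite) (hGc : G ⊆ unitCube d) :
    T G ≤ ∑ a, T (G ∩ {x | g x = a}) + Fintype.card α * d := by
  classical
  have key : ∀ S : Finset α, T (G ∩ {x | g x ∈ S}) ≤
      ∑ a ∈ S, T (G ∩ {x | g x = a}) + S.card * d := by
    intro S
    induction S using Finset.induction_on with
    | empty => simp [T_empty]
    | insert a S ha ih =>
      rw [Finset.sum_insert ha, Finset.card_insert_of_notMem ha]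
      have e1 : G ∩ {x | g x ∈ insert a S} = (G ∩ {x | g x = a}) ∪ (G ∩ {x | g x ∈ S}) := by
        ext x; simp; tauto
      rw [e1]
      have := T_union_le (G ∩ {x | g x = a}) (G ∩ {x | g x ∈ S})
        (hG.subset Set.inter_subset_left) (hG.subset Set.inter_subset_left)
        (Set.inter_subset_left.trans hGc) (Set.inter_subset_left.trans hGc)
      push_cast
      linarith
  have := key Finset.univ
  simpa using this

theorem cell_eq {d : ℕ} (m : ℕ) (hm : 1 ≤ m) (k : Fin d → Fin m) (x : EuclideanSpace ℝ (Fin d))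
    (hx : x ∈ unitCube d) :
    x ∈ cell m k ↔ (fun i => (⟨lab m (x i), lab_lt m hm _⟩ : Fin m)) = k := by
  have hm0 : (0:ℝ) < m := by exact_mod_cast hm
  rw [funext_iff]
  change (∀ i, _) ↔ _
  refine forall_congr' fun i => ?_
  have h0 : 0 ≤ (m:ℝ) * x i := mul_nonneg hm0.le (hx i).1
  have h1 : (k i : ℝ) / m ≤ x i ↔ (k i : ℕ) ≤ ⌊(m:ℝ) * x i⌋₊ := by
    rw [Nat.le_floor_iff h0, div_le_iff₀ hm0, mul_comm]
  have h2 : x i < ((k i : ℝ) + 1) / m ↔ ⌊(m:ℝ) * x i⌋₊ < (k i : ℕ) + 1 := by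
    rw [Nat.floor_lt h0, lt_div_iff₀ hm0, mul_comm]; push_cast; rfl
  rw [Fin.ext_iff]
  have hk := (k i).2
  simp only [lab]
  split_ifs with h
  · have h3 : x i ≤ ((k i : ℝ) + 1) / m := by
      have : ((k i : ℝ) + 1) = m := by exact_mod_cast h
      rw [this, div_self hm0.ne']; exact (hx i).2
    rw [Set.mem_Icc, h1]
    constructor
    · rintro ⟨h4, -⟩; omega
    · intro h4; exact ⟨by omega, h3⟩
  · rw [Set.mem_Ico, h1, h2]
    omega

end Helpers

/-- The TSP in the unit cube is well approximated by the sum of the TSPs over a grid of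
congruent subcubes: for `d ≥ 2` and an integer `m ≥ 1`, there is a constant `C(d,m)` such
that for every finite set `F` of `n` points in `Ω = [0,1]^d`,
`|T(F, Ω) − Σ_k T(F, ω_k)| ≤ C(d,m) · n^((d-2)/(d-1))`, where the `ω_k` (`k : Fin d → Fin m`)
are the `m^d` congruent subcubes of edge length `1/m` partitioning `Ω`. -/
theorem abs_TSP_sub_sum_subcube_TSP_le (d : ℕ) (hd : 2 ≤ d) (m : ℕ) (hm : 1 ≤ m) :
    ∃ C : ℝ, ∀ F : Set (EuclideanSpace ℝ (Fin d)), F.Finite → F ⊆ unitCube d →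
      |T (F ∩ unitCube d) - ∑ k : Fin d → Fin m, T (F ∩ cell m k)|
        ≤ C * (F.ncard : ℝ) ^ (((d:ℝ) - 2) / ((d:ℝ) - 1)) := by
  classical
  choose c hc0 hc using fun i : Fin d => two_split hd i
  obtain ⟨a, ha0, ha⟩ := splits_pi (d := d) (β := Fin m) d
  set cs := ∑ i, c i with hcs
  have hcs0 : 0 ≤ cs := Finset.sum_nonneg fun i _ => hc0 i
  have hci : ∀ i, c i ≤ cs := fun i => Finset.single_le_sum (fun j _ => hc0 j) (Finset.mem_univ i)
  set M : ℝ := (Fintype.card (Fin d → Fin m) : ℝ) * d with hMdef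
  have hM : 0 ≤ M := by positivity
  set R : ℝ := 2 + cs * (2 ^ (d - 2) + 2) with hR
  have hR0 : 0 ≤ R := by positivity
  refine ⟨M + a * (m * R), fun F hF hFc => ?_⟩
  have hC0 : 0 ≤ M + a * (m * R) := by positivity
  have hFu : F ∩ unitCube d = F := Set.inter_eq_left.2 hFc
  rw [hFu]
  rcases Nat.eq_zero_or_pos F.ncard with h0 | hpos
  · have hFe : F = ∅ := (Set.ncard_eq_zero hF).1 h0
    subst hFe
    simp only [Set.empty_inter, T_empty, Finset.sum_const_zero, sub_zero, abs_zero]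
    positivity
  set n := F.ncard with hn
  have hn1 : (1:ℝ) ≤ n := by exact_mod_cast hpos
  have hd2 : (2:ℝ) ≤ d := by exact_mod_cast hd
  have hd1 : (0:ℝ) < (d:ℝ) - 1 := by linarith
  set φ := (n:ℝ) ^ (((d:ℝ) - 2) / ((d:ℝ) - 1)) with hφ
  have hφ1 : 1 ≤ φ := Real.one_le_rpow hn1 (div_nonneg (by linarith) hd1.le)
  set u := (n:ℝ) ^ (1 / ((d:ℝ) - 1)) with hu
  have hu1 : 1 ≤ u := Real.one_le_rpow hn1 (by positivity)
  have hφu : φ * u = n := by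
    rw [hφ, hu, ← Real.rpow_add (by linarith), ← add_div,
      show (d:ℝ) - 2 + 1 = (d:ℝ) - 1 by ring, div_self hd1.ne', Real.rpow_one]
  have hupow : u ^ (d - 2) = φ := by
    rw [hφ, hu, ← Real.rpow_natCast, ← Real.rpow_mul (by linarith)]
    congr 1
    rw [Nat.cast_sub hd]; push_cast; ring
  set N := ⌈u⌉₊ with hN
  have hNu : u ≤ N := Nat.le_ceil u
  have hN1 : 1 ≤ N := by exact_mod_cast hu1.trans hNu
  have hN2 : (N:ℝ) ≤ 2 * u := by
    have := Nat.ceil_lt_add_one (by linarith : 0 ≤ u)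
    linarith
  have hN0 : (0:ℝ) < N := by linarith
  have hQ : (N:ℝ) ^ (d - 2) + (2 * n : ℕ) / N ≤ (2 ^ (d - 2) + 2) * φ := by
    have h1 : (N:ℝ) ^ (d - 2) ≤ 2 ^ (d - 2) * φ := by
      rw [← hupow, ← mul_pow]; gcongr
    have h2 : ((2 * n : ℕ) : ℝ) / N ≤ 2 * φ := by
      rw [div_le_iff₀ hN0]; push_cast; rw [← hφu]
      nlinarith [mul_le_mul_of_nonneg_left hNu (by linarith : 0 ≤ φ)]
    linarith
  have hQ0 : 0 ≤ (N:ℝ) ^ (d - 2) + (2 * n : ℕ) / N := by positivity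
  have hRφ : 0 ≤ R * φ := by positivity
  have hsp := ha n (m * (R * φ)) (by positivity)
    (fun i x => (⟨lab m (x i), lab_lt m hm _⟩ : Fin m)) (fun i => by
      refine slabs_split i n (R * φ) hRφ m hm ?_
      intro t ht G hG hGc hGn
      refine (hc i N hN1 t ht n G hG hGc hGn).trans ?_
      have : c i * ((N:ℝ) ^ (d - 2) + (2 * n : ℕ) / N) ≤ cs * ((2 ^ (d - 2) + 2) * φ) :=
        mul_le_mul (hci i) hQ hQ0 hcs0
      rw [hR]
      nlinarith) F hF hFc le_rfl
  have hup := T_le_sum (fun x : EuclideanSpace ℝ (Fin d) => fun i =>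
    (⟨lab m (x i), lab_lt m hm _⟩ : Fin m)) F hF hFc
  have hcell : ∀ k : Fin d → Fin m, F ∩ cell m k =
      F ∩ {x | (fun i => (⟨lab m (x i), lab_lt m hm _⟩ : Fin m)) = k} := by
    intro k
    ext x
    exact and_congr_right fun hx => cell_eq m hm k x (hFc hx)
  simp only [hcell]
  have hMφ : M ≤ M * φ := le_mul_of_one_le_right hM hφ1
  have haφ : 0 ≤ a * (m * (R * φ)) := by positivity
  have hex : (M + a * (m * R)) * φ = M * φ + a * (m * (R * φ)) := by ring
  rw [hex, abs_le]
  have hMφ0 : 0 ≤ M * φ := hM.trans hMφ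
  constructor
  · linarith
  · linarith

end
end
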